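/- arXiv:2511.10039 — 7 statements merged into one kernel-verified Lean document; each statement's English description precedes it below -/
import Mathlib

section
/- Let Ω ⊆ ℝ^N be an open set, p ≥ 2 a real number, h ≥ 1 a natural number, and σ : ℝ^N → M_{h×N}(ℝ) a continuous matrix-valued function; write ∇_L u(x) := σ(x)∇u(x) ∈ ℂ^h. Let Z : Ω → ℝ^h be a measurable vector field, V : Ω → ℝ with V(x) ≥ 0 on Ω, W : Ω → ℝ locally integrable on Ω, and assume V·|Z|^p is locally integrable on Ω. Let λ > 0. Suppose there exists a real-valued C¹ function h₀ on Ω with h₀(x) ≠ 0 for every x ∈ Ω such that for every φ ∈ C^∞_c(Ω;ℂ): ∫_Ω V |∇_L h₀·Z|^{p−2} (∇_L h₀·Z) (∇_L φ·Z) dx = λ ∫_Ω W |h₀|^{p−2} h₀ φ dx (both integrals being absolutely convergent). Then for every u ∈ C^∞_c(Ω;ℂ): ∫_Ω V(x) |∇_L u(x)·Z(x)|^p dx ≥ λ ∫_Ω W(x) |u(x)|^p dx. -/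
open MeasureTheory Real

noncomputable section

/-- The derivative of `u` at `x` in the direction of the vector `v : Fin N → ℝ`,
viewed as an element of `EuclideanSpace ℝ (Fin N)`.  For `u` differentiable this is
`∇u(x) · v`. -/
def dirDeriv {N : ℕ} (u : EuclideanSpace ℝ (Fin N) → ℂ) (x : EuclideanSpace ℝ (Fin N))
    (v : Fin N → ℝ) : ℂ :=
  fderiv ℝ u x ((WithLp.equiv 2 (Fin N → ℝ)).symm v)

/-- Real-valued version of `dirDeriv`. -/
def dirDerivR {N : ℕ} (u : EuclideanSpace ℝ (Fin N) → ℝ) (x : EuclideanSpace ℝ (Fin N))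
    (v : Fin N → ℝ) : ℝ :=
  fderiv ℝ u x ((WithLp.equiv 2 (Fin N → ℝ)).symm v)

open Filter Topology in
theorem aux_mollify {N : ℕ} {Ω : Set (EuclideanSpace ℝ (Fin N))} (hΩ : IsOpen Ω)
    (φ : EuclideanSpace ℝ (Fin N) → ℝ) (hφ : ContDiff ℝ 1 φ) (hc : HasCompactSupport φ)
    (hs : tsupport φ ⊆ Ω) :
    ∃ (K : Set (EuclideanSpace ℝ (Fin N))) (C : ℝ) (ψ : ℕ → EuclideanSpace ℝ (Fin N) → ℝ),
      IsCompact K ∧ K ⊆ Ω ∧ (∀ n, ContDiff ℝ (⊤ : ℕ∞) (ψ n)) ∧ (∀ n, tsupport (ψ n) ⊆ K) ∧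
      (∀ n x, ‖ψ n x‖ ≤ C) ∧ (∀ n x, ‖fderiv ℝ (ψ n) x‖ ≤ C) ∧
      (∀ x, Tendsto (fun n => ψ n x) atTop (𝓝 (φ x))) ∧
      (∀ x, Tendsto (fun n => fderiv ℝ (ψ n) x) atTop (𝓝 (fderiv ℝ φ x))) := by
  obtain ⟨δ, hδ, hδΩ⟩ := hc.isCompact.exists_cthickening_subset_open hΩ hs
  have hφc := hφ.continuous
  have hdc : Continuous (fderiv ℝ φ) := hφ.continuous_fderiv one_ne_zero
  obtain ⟨C₁, hC₁⟩ := hc.exists_bound_of_continuous hφc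
  obtain ⟨C₂, hC₂⟩ := (hc.fderiv ℝ).exists_bound_of_continuous hdc
  have hpos : ∀ n : ℕ, 0 < δ / ((n : ℝ) + 2) := fun n => by positivity
  let b : ℕ → ContDiffBump (0 : EuclideanSpace ℝ (Fin N)) := fun n =>
    ⟨δ / ((n : ℝ) + 2) / 2, δ / ((n : ℝ) + 2), half_pos (hpos n), half_lt_self (hpos n)⟩
  have hb : Tendsto (fun n => (b n).rOut) atTop (𝓝 0) := by
    have : Tendsto (fun n : ℕ => (n : ℝ) + 2) atTop atTop :=
      tendsto_atTop_add_const_right _ _ tendsto_natCast_atTop_atTop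
    exact this.const_div_atTop δ
  have hbδ : ∀ n, (b n).rOut ≤ δ := fun n => by
    change δ / ((n : ℝ) + 2) ≤ δ
    apply div_le_self hδ.le
    have : (0 : ℝ) ≤ n := n.cast_nonneg
    linarith
  have hfd : ∀ n x, fderiv ℝ (convolution ((b n).normed volume) φ (ContinuousLinearMap.lsmul ℝ ℝ) volume) x
      = convolution ((b n).normed volume) (fderiv ℝ φ) (ContinuousLinearMap.lsmul ℝ ℝ) volume x := by
    intro n x
    have h := hc.hasFDerivAt_convolution_right (μ := volume) (ContinuousLinearMap.lsmul ℝ ℝ)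
      (f := (b n).normed volume) ((b n).continuous_normed.locallyIntegrable) hφ x
    rw [h.fderiv]
    rfl
  have key : ∀ {F : Type} [NormedAddCommGroup F] [NormedSpace ℝ F] [CompleteSpace F] (g : EuclideanSpace ℝ (Fin N) → F) (C : ℝ)
      (hg : Continuous g) (hgC : ∀ x, ‖g x‖ ≤ C) (n : ℕ) (x),
      ‖convolution ((b n).normed volume) g (ContinuousLinearMap.lsmul ℝ ℝ) volume x‖ ≤ 3 * C := by
    intro F _ _ _ g C hg hgC n x
    have h := (b n).dist_normed_convolution_le (μ := volume) (g := g) (x₀ := x) (ε := 2 * C)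
      hg.aestronglyMeasurable (fun y _ => by
        rw [dist_eq_norm]
        have := norm_sub_le (g y) (g x)
        linarith [hgC y, hgC x])
    rw [dist_eq_norm] at h
    have h2 := norm_le_norm_add_norm_sub' (convolution ((b n).normed volume) g (ContinuousLinearMap.lsmul ℝ ℝ) volume x) (g x)
    linarith [hgC x]
  refine ⟨Metric.cthickening δ (tsupport φ), max (3 * C₁) (3 * C₂),
    fun n => convolution ((b n).normed volume) φ (ContinuousLinearMap.lsmul ℝ ℝ) volume,
    hc.isCompact.cthickening, hδΩ, ?_, ?_, ?_, ?_, ?_, ?_⟩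
  · intro n
    exact (b n).hasCompactSupport_normed.contDiff_convolution_left _ (b n).contDiff_normed
      hφc.locallyIntegrable
  · intro n
    apply closure_minimal _ Metric.isClosed_cthickening
    refine (support_convolution_subset _).trans ?_
    rintro _ ⟨y, hy, z, hz, rfl⟩
    rw [(b n).support_normed_eq, mem_ball_zero_iff] at hy
    apply Metric.mem_cthickening_of_dist_le _ z δ _ (subset_tsupport _ hz)
    simp only [dist_add_self_left]
    linarith [hbδ n]
  · intro n x
    exact (key φ C₁ hφc hC₁ n x).trans (le_max_left _ _)
  · intro n x
    rw [hfd]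
    exact (key _ C₂ hdc hC₂ n x).trans (le_max_right _ _)
  · intro x
    exact ContDiffBump.convolution_tendsto_right_of_continuous hb hφc x
  · intro x
    simp_rw [hfd]
    exact ContDiffBump.convolution_tendsto_right_of_continuous hb hdc x

theorem aux_intOn {E F : Type*} [NormedAddCommGroup F] [TopologicalSpace E] [MeasurableSpace E] {μ : Measure E}
    {Ω K : Set E} [OpensMeasurableSpace E] (hΩ : IsOpen Ω)
    {f : E → F} (hf : LocallyIntegrableOn f Ω μ) (hK : IsCompact K) (hKΩ : K ⊆ Ω)
    (h0 : ∀ x, x ∉ K → f x = 0) : IntegrableOn f Ω μ :=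
  (hf.integrableOn_compact_subset hKΩ hK).of_forall_sdiff_eq_zero hΩ.measurableSet
    fun x hx => h0 x hx.2

theorem aux_locInt {N : ℕ} {F : Type*} [NormedAddCommGroup F]
    {Ω : Set (EuclideanSpace ℝ (Fin N))} (hΩ : IsOpen Ω)
    {f : EuclideanSpace ℝ (Fin N) → F} {m : EuclideanSpace ℝ (Fin N) → ℝ}
    (hm : LocallyIntegrableOn m Ω volume)
    (hf : AEStronglyMeasurable f (volume.restrict Ω)) (hb : ∀ x ∈ Ω, ‖f x‖ ≤ m x) :
    LocallyIntegrableOn f Ω volume := by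
  rw [locallyIntegrableOn_iff hΩ.isLocallyClosed] at hm ⊢
  intro k hk hkc
  refine (hm k hk hkc).mono' (hf.mono_measure (Measure.restrict_mono hk le_rfl)) ?_
  filter_upwards [ae_restrict_mem hkc.measurableSet] with x hx using hb x (hk hx)

open Filter Topology in
theorem aux_extend {N : ℕ} {Ω : Set (EuclideanSpace ℝ (Fin N))} (hΩ : IsOpen Ω)
    (X : EuclideanSpace ℝ (Fin N) → EuclideanSpace ℝ (Fin N)) (g : EuclideanSpace ℝ (Fin N) → ℝ)
    (hX : LocallyIntegrableOn X Ω volume) (hg : LocallyIntegrableOn g Ω volume)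
    (H : ∀ φ : EuclideanSpace ℝ (Fin N) → ℝ, ContDiff ℝ (⊤ : ℕ∞) φ → HasCompactSupport φ →
      tsupport φ ⊆ Ω → ∫ x in Ω, fderiv ℝ φ x (X x) = ∫ x in Ω, g x * φ x)
    (φ : EuclideanSpace ℝ (Fin N) → ℝ) (hφ : ContDiff ℝ 1 φ) (hc : HasCompactSupport φ)
    (hs : tsupport φ ⊆ Ω) :
    IntegrableOn (fun x => fderiv ℝ φ x (X x)) Ω ∧ 
    ∫ x in Ω, fderiv ℝ φ x (X x) = ∫ x in Ω, g x * φ x := by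
  have meas : ∀ f : EuclideanSpace ℝ (Fin N) → (EuclideanSpace ℝ (Fin N) →L[ℝ] ℝ), Continuous f →
      AEStronglyMeasurable (fun x => f x (X x)) (volume.restrict Ω) := fun f hf =>
    isBoundedBilinearMap_apply.continuous.comp_aestronglyMeasurable
      (hf.aestronglyMeasurable.prodMk hX.aestronglyMeasurable)
  obtain ⟨K, C, ψ, hK, hKΩ, hψ, hψK, hψC, hψdC, ht, htd⟩ := aux_mollify hΩ φ hφ hc hs
  have hKm := hK.measurableSet
  have hC : 0 ≤ C := (norm_nonneg _).trans (hψC 0 0)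
  constructor
  · refine aux_intOn (K := tsupport φ) hΩ (aux_locInt hΩ (m := fun x => ‖fderiv ℝ φ x‖ * ‖X x‖) ?_
      (meas _ (hφ.continuous_fderiv one_ne_zero)) ?_) hc.isCompact hs ?_
    · exact LocallyIntegrableOn.continuousOn_mul (LocallyIntegrableOn.norm hX)
        (hφ.continuous_fderiv one_ne_zero).norm.continuousOn hΩ.isLocallyClosed
    · intro x _
      exact ContinuousLinearMap.le_opNorm _ _
    · intro x hx
      have : fderiv ℝ φ x = 0 := image_eq_zero_of_notMem_tsupport
        (fun h => hx (tsupport_fderiv_subset ℝ h))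
      simp [this]
  have hψc : ∀ n, HasCompactSupport (ψ n) := fun n =>
    hK.of_isClosed_subset (isClosed_tsupport _) (hψK n)
  have h1 : Tendsto (fun n => ∫ x in Ω, fderiv ℝ (ψ n) x (X x)) atTop
      (𝓝 (∫ x in Ω, fderiv ℝ φ x (X x))) := by
    refine tendsto_integral_of_dominated_convergence (K.indicator fun x => C * ‖X x‖) ?_ ?_ ?_ ?_
    · intro n
      exact meas _ ((hψ n).continuous_fderiv (by simp))
    · rw [integrable_indicator_iff hKm]
      have := (hX.integrableOn_compact_subset hKΩ hK).norm.const_mul C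
      exact this.mono_measure (Measure.restrict_mono_measure Measure.restrict_le_self _)
    · intro n
      refine ae_of_all _ fun x => ?_
      by_cases hx : x ∈ K
      · rw [Set.indicator_of_mem hx]
        exact ((fderiv ℝ (ψ n) x).le_opNorm _).trans (by gcongr; exact hψdC n x)
      · have : fderiv ℝ (ψ n) x = 0 := image_eq_zero_of_notMem_tsupport
          (fun h => hx (hψK n (tsupport_fderiv_subset ℝ h)))
        simp [this, hx]
    · refine ae_of_all _ fun x => ?_
      exact ((ContinuousLinearMap.apply ℝ ℝ (X x)).continuous.tendsto _).comp (htd x)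
  have h2 : Tendsto (fun n => ∫ x in Ω, g x * ψ n x) atTop
      (𝓝 (∫ x in Ω, g x * φ x)) := by
    refine tendsto_integral_of_dominated_convergence (K.indicator fun x => C * ‖g x‖) ?_ ?_ ?_ ?_
    · intro n
      exact hg.aestronglyMeasurable.mul (hψ n).continuous.aestronglyMeasurable
    · rw [integrable_indicator_iff hKm]
      have := (hg.integrableOn_compact_subset hKΩ hK).norm.const_mul C
      exact this.mono_measure (Measure.restrict_mono_measure Measure.restrict_le_self _)
    · intro n
      refine ae_of_all _ fun x => ?_
      by_cases hx : x ∈ K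
      · rw [Set.indicator_of_mem hx, norm_mul, mul_comm]
        gcongr; exact hψC n x
      · have : ψ n x = 0 := image_eq_zero_of_notMem_tsupport (fun h => hx (hψK n h))
        simp [this, hx]
    · exact ae_of_all _ fun x => (ht x).const_mul _
  refine tendsto_nhds_unique h1 (h2.congr fun n => ?_)
  exact (H (ψ n) (hψ n) (hψc n) ((hψK n).trans hKΩ)).symm

theorem aux_deriv (p : ℝ) (t : ℝ) (ht : t ≠ 0) :
    HasDerivAt (fun t : ℝ => |t| ^ (-p) * t) ((1 - p) * |t| ^ (-p)) t := by
  have h0 : |t| ≠ 0 := abs_ne_zero.2 ht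
  have h := ((hasDerivAt_abs ht).rpow_const (p := -p) (Or.inl h0)).mul (hasDerivAt_id t)
  refine HasDerivAt.congr_deriv (f' := _) h ?_
  simp only [id]
  rw [rpow_sub_one h0]
  have : (SignType.sign t : ℝ) * t = |t| := by
    rw [sign_mul_self]
  field_simp
  linear_combination (-p) * this

/-- Picone's pointwise inequality. -/
theorem aux_picone {p : ℝ} (hp : 2 ≤ p) (a h : ℝ) (hh : h ≠ 0) (u b : ℂ) :
    |a| ^ (p - 2) * a * ((p * ‖u‖ ^ (p - 2) * inner ℝ u b) * (|h| ^ (-p) * h) +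
      ‖u‖ ^ p * ((1 - p) * |h| ^ (-p) * a)) ≤ ‖b‖ ^ p := by
  have hh' : 0 < |h| := abs_pos.2 hh
  have hp0 : 0 < p := by linarith
  set A := |a|
  set U := ‖u‖
  set H := |h|
  set B := ‖b‖
  have hA : 0 ≤ A := abs_nonneg _
  have hU : 0 ≤ U := norm_nonneg _
  have hB : 0 ≤ B := norm_nonneg _
  set t := A * U / H
  have ht : 0 ≤ t := by positivity
  have pw : ∀ x : ℝ, 0 ≤ x → x ^ (p - 2) * x = x ^ (p - 1) := fun x hx => by
    rw [show p - 1 = (p - 2) + 1 by ring, rpow_add_one' hx (by linarith)]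
  have pw2 : ∀ x : ℝ, 0 ≤ x → x ^ (p - 1) * x = x ^ p := fun x hx => by
    conv_rhs => rw [show p = (p - 1) + 1 by ring, rpow_add_one' hx (by linarith)]
  have e1 : A ^ (p - 2) * a * (U ^ p * ((1 - p) * H ^ (-p) * a)) = (1 - p) * t ^ p := by
    have : a * a = A * A := (abs_mul_abs_self a).symm
    rw [div_rpow (by positivity) hh'.le, mul_rpow hA hU, rpow_neg hh'.le, ← pw2 A hA, ← pw A hA]
    rw [div_eq_mul_inv]
    linear_combination A ^ (p - 2) * (U ^ p * ((1 - p) * (H ^ p)⁻¹)) * this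
  have e2 : A ^ (p - 2) * a * ((p * U ^ (p - 2) * inner ℝ u b) * (H ^ (-p) * h)) ≤
      p * (t ^ (p - 1) * B) := by
    have hin : a * inner ℝ u b * h ≤ A * (U * B) * H := by
      refine (le_abs_self _).trans ?_
      rw [abs_mul, abs_mul]
      gcongr
      exact abs_real_inner_le_norm u b
    calc _ = A ^ (p - 2) * p * U ^ (p - 2) * H ^ (-p) * (a * inner ℝ u b * h) := by ring
      _ ≤ A ^ (p - 2) * p * U ^ (p - 2) * H ^ (-p) * (A * (U * B) * H) := by gcongr
      _ = _ := by
        rw [div_rpow (by positivity) hh'.le, mul_rpow hA hU, rpow_neg hh'.le, ← pw2 H hh'.le,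
          ← pw A hA, ← pw U hU]
        have : H ^ (p - 1) ≠ 0 := (rpow_pos_of_pos hh' _).ne'
        field_simp
  have y : t ^ (p - 1) * B ≤ (p - 1) / p * t ^ p + 1 / p * B ^ p := by
    have := geom_mean_le_arith_mean2_weighted (w₁ := (p - 1) / p) (w₂ := 1 / p)
      (p₁ := t ^ p) (p₂ := B ^ p) (by apply div_nonneg <;> linarith) (by positivity)
      (by positivity) (by positivity) (by field_simp; ring)
    rw [← rpow_mul ht, ← rpow_mul hB] at this
    rwa [mul_div_cancel₀ _ hp0.ne', mul_one_div_cancel hp0.ne', rpow_one] at this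
  have y2 : p * (t ^ (p - 1) * B) ≤ (p - 1) * t ^ p + B ^ p := by
    have := mul_le_mul_of_nonneg_left y hp0.le
    calc _ ≤ _ := this
      _ = _ := by field_simp
  rw [mul_add, e1]
  linarith

/-- **Hardy-type inequality along a vector field `Z`.**
Here `∇_L u(x) = σ(x) ∇u(x)` and `∇_L u · Z = ∇u(x) · (σ(x)ᵀ Z(x))`, so the directional
quantity `∇_L u · Z` is encoded as the derivative of `u` along the vector
`j ↦ ∑ i, σ x i j * Z x i`. -/
theorem hardy_along_Z
    {N hdim : ℕ} (hhdim : 1 ≤ hdim)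
    {p : ℝ} (hp : 2 ≤ p)
    {Ω : Set (EuclideanSpace ℝ (Fin N))} (hΩ : IsOpen Ω)
    (σ : EuclideanSpace ℝ (Fin N) → Matrix (Fin hdim) (Fin N) ℝ)
    (hσ : Continuous σ)
    (Z : EuclideanSpace ℝ (Fin N) → EuclideanSpace ℝ (Fin hdim))
    (hZ : Measurable Z)
    (V W : EuclideanSpace ℝ (Fin N) → ℝ)
    (hV : ∀ x ∈ Ω, 0 ≤ V x)
    (hW : LocallyIntegrableOn W Ω volume)
    (hVZ : LocallyIntegrableOn (fun x => V x * ‖Z x‖ ^ p) Ω volume)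
    {lam : ℝ} (hlam : 0 < lam)
    (h₀ : EuclideanSpace ℝ (Fin N) → ℝ)
    (hh₀ : ContDiffOn ℝ 1 h₀ Ω)
    (hh₀ne : ∀ x ∈ Ω, h₀ x ≠ 0)
    (heq : ∀ φ : EuclideanSpace ℝ (Fin N) → ℂ,
      ContDiff ℝ (⊤ : ℕ∞) φ → HasCompactSupport φ → tsupport φ ⊆ Ω →
      IntegrableOn (fun x =>
        (V x * |dirDerivR h₀ x (fun j => ∑ i, σ x i j * Z x i)| ^ (p - 2) *
            dirDerivR h₀ x (fun j => ∑ i, σ x i j * Z x i)) •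
          dirDeriv φ x (fun j => ∑ i, σ x i j * Z x i)) Ω volume ∧
      IntegrableOn (fun x => (W x * |h₀ x| ^ (p - 2) * h₀ x) • φ x) Ω volume ∧
      ∫ x in Ω,
          (V x * |dirDerivR h₀ x (fun j => ∑ i, σ x i j * Z x i)| ^ (p - 2) *
              dirDerivR h₀ x (fun j => ∑ i, σ x i j * Z x i)) •
            dirDeriv φ x (fun j => ∑ i, σ x i j * Z x i)
        = lam • ∫ x in Ω, (W x * |h₀ x| ^ (p - 2) * h₀ x) • φ x) :
    ∀ u : EuclideanSpace ℝ (Fin N) → ℂ,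
      ContDiff ℝ (⊤ : ℕ∞) u → HasCompactSupport u → tsupport u ⊆ Ω →
      lam * ∫ x in Ω, W x * ‖u x‖ ^ p
        ≤ ∫ x in Ω, V x * ‖dirDeriv u x (fun j => ∑ i, σ x i j * Z x i)‖ ^ p := by
  intro u hu huc hus
  have hp0 : 0 < p := by linarith
  have hΩm := hΩ.measurableSet
  set v : EuclideanSpace ℝ (Fin N) → EuclideanSpace ℝ (Fin N) := fun x =>
    (WithLp.equiv 2 (Fin N → ℝ)).symm (fun j => ∑ i, σ x i j * Z x i) with hv
  let r : Fin hdim → EuclideanSpace ℝ (Fin N) → EuclideanSpace ℝ (Fin N) := fun i x =>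
    WithLp.toLp 2 (σ x i)
  have hr : ∀ i, Continuous (r i) := fun i =>
    (PiLp.continuous_toLp 2 _).comp ((continuous_apply i).comp hσ)
  have hvr : ∀ x, v x = ∑ i, Z x i • r i x := by
    intro x
    ext j
    simp [hv, r, mul_comm]
  let ρ : EuclideanSpace ℝ (Fin N) → ℝ := fun x => ∑ i, ‖r i x‖
  have hρ : Continuous ρ := continuous_finsetSum _ fun i _ => (hr i).norm
  have hρ0 : ∀ x, 0 ≤ ρ x := fun x => Finset.sum_nonneg fun i _ => norm_nonneg _
  have hvρ : ∀ x, ‖v x‖ ≤ ρ x * ‖Z x‖ := by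
    intro x
    rw [hvr, Finset.sum_mul]
    refine norm_sum_le_of_le _ fun i _ => ?_
    rw [norm_smul, mul_comm]
    gcongr
    exact PiLp.norm_apply_le (Z x) i
  have hvm : Measurable v := by
    have : v = fun x => ∑ i, Z x i • r i x := funext hvr
    rw [this]
    refine Finset.measurable_sum _ fun i _ => ?_
    have hZi : Measurable fun x => Z x i :=
      (EuclideanSpace.proj (𝕜 := ℝ) i).continuous.measurable.comp hZ
    exact hZi.smul (hr i).measurable
  have hv0 : ∀ x, Z x = 0 → v x = 0 := fun x hx => by
    have := hvρ x
    rw [hx, norm_zero, mul_zero] at this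
    exact norm_le_zero_iff.1 this
  have hvm' : AEStronglyMeasurable v (volume.restrict Ω) := hvm.aestronglyMeasurable
  -- measurability of products with `V`
  have hVmeas : ∀ {F : Type} [NormedAddCommGroup F] [NormedSpace ℝ F]
      (c : EuclideanSpace ℝ (Fin N) → F), AEStronglyMeasurable c (volume.restrict Ω) →
      (∀ x, Z x = 0 → c x = 0) →
      AEStronglyMeasurable (fun x => V x • c x) (volume.restrict Ω) := by
    intro F _ _ c hc h0
    have h1 : AEStronglyMeasurable (fun x => (V x * ‖Z x‖ ^ p) • ((‖Z x‖ ^ p)⁻¹ • c x))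
        (volume.restrict Ω) := by
      refine hVZ.aestronglyMeasurable.smul (AEStronglyMeasurable.smul ?_ hc)
      exact ((hZ.norm.pow_const p).inv).aestronglyMeasurable
    refine h1.congr (ae_of_all _ fun x => ?_)
    by_cases hx : Z x = 0
    · simp [h0 x hx]
    · have : ‖Z x‖ ^ p ≠ 0 := (rpow_pos_of_pos (norm_pos_iff.2 hx) _).ne'
      simp only [smul_smul]
      congr 1
      field_simp
  have hdh : ContinuousOn (fderiv ℝ h₀) Ω := hh₀.continuousOn_fderiv_of_isOpen hΩ le_rfl
  have hh₀c : ContinuousOn h₀ Ω := hh₀.continuousOn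
  have happ : ∀ {F : Type} [NormedAddCommGroup F] [NormedSpace ℝ F]
      (f : EuclideanSpace ℝ (Fin N) → (EuclideanSpace ℝ (Fin N) →L[ℝ] F)), ContinuousOn f Ω →
      AEStronglyMeasurable (fun x => f x (v x)) (volume.restrict Ω) := fun f hf =>
    isBoundedBilinearMap_apply.continuous.comp_aestronglyMeasurable
      ((hf.aestronglyMeasurable hΩm).prodMk hvm')
  let a : EuclideanSpace ℝ (Fin N) → ℝ := fun x => fderiv ℝ h₀ x (v x)
  let X : EuclideanSpace ℝ (Fin N) → EuclideanSpace ℝ (Fin N) := fun x =>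
    (V x * |a x| ^ (p - 2) * a x) • v x
  have ham : AEStronglyMeasurable a (volume.restrict Ω) := happ _ hdh
  have hX : LocallyIntegrableOn X Ω volume := by
    refine aux_locInt hΩ (m := fun x => (‖fderiv ℝ h₀ x‖ ^ (p - 1) * ρ x ^ p) *
      (V x * ‖Z x‖ ^ p)) ?_ ?_ ?_
    · refine LocallyIntegrableOn.continuousOn_mul hVZ ?_ hΩ.isLocallyClosed
      refine ContinuousOn.mul (hdh.norm.rpow_const fun x _ => Or.inr (by linarith))
        (hρ.continuousOn.rpow_const fun x _ => Or.inr hp0.le)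
    · have := hVmeas (fun x => (|a x| ^ (p - 2) * a x) • v x) (by
        refine AEStronglyMeasurable.smul (AEStronglyMeasurable.mul ?_ ham) hvm'
        exact (Real.continuous_rpow_const (by linarith)).comp_aestronglyMeasurable
          (continuous_abs.comp_aestronglyMeasurable ham)) (fun x hx => by simp [hv0 x hx])
      refine this.congr (ae_of_all _ fun x => ?_)
      simp only [X, smul_smul, mul_assoc]
    · intro x hx
      have hVx := hV x hx
      have h1 : |a x| ≤ ‖fderiv ℝ h₀ x‖ * ‖v x‖ := (fderiv ℝ h₀ x).le_opNorm _
      have h2 : |a x| ^ (p - 2) * |a x| = |a x| ^ (p - 1) := by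
        rw [show p - 1 = (p - 2) + 1 by ring, rpow_add_one' (abs_nonneg _) (by linarith)]
      have h3 : ‖v x‖ ^ (p - 1) * ‖v x‖ = ‖v x‖ ^ p := by
        conv_rhs => rw [show p = (p - 1) + 1 by ring, rpow_add_one' (norm_nonneg _) (by linarith)]
      have hn : ‖X x‖ = V x * |a x| ^ (p - 1) * ‖v x‖ := by
        simp only [X]
        rw [norm_smul, norm_mul, norm_mul, Real.norm_eq_abs, Real.norm_eq_abs, Real.norm_eq_abs,
          abs_of_nonneg hVx, abs_of_nonneg (rpow_nonneg (abs_nonneg _) _), mul_assoc (V x), h2]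
      rw [hn]
      calc V x * |a x| ^ (p - 1) * ‖v x‖
          ≤ V x * (‖fderiv ℝ h₀ x‖ * ‖v x‖) ^ (p - 1) * ‖v x‖ := by
            gcongr
            linarith
        _ = ‖fderiv ℝ h₀ x‖ ^ (p - 1) * V x * ‖v x‖ ^ p := by
            rw [mul_rpow (norm_nonneg _) (norm_nonneg _), ← h3]; ring
        _ ≤ ‖fderiv ℝ h₀ x‖ ^ (p - 1) * V x * (ρ x * ‖Z x‖) ^ p := by
            gcongr
            exact hvρ x
        _ = _ := by
            rw [mul_rpow (hρ0 x) (norm_nonneg _)]; ring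
  let g : EuclideanSpace ℝ (Fin N) → ℝ := fun x => lam * (W x * |h₀ x| ^ (p - 2) * h₀ x)
  have hg : LocallyIntegrableOn g Ω volume := by
    have := LocallyIntegrableOn.continuousOn_mul hW
      (g := fun x => lam * |h₀ x| ^ (p - 2) * h₀ x) ?_ hΩ.isLocallyClosed
    · have e : g = fun x => (lam * |h₀ x| ^ (p - 2) * h₀ x) * W x := by
        funext x
        simp only [g]
        ring
      rw [e]
      exact this
    · exact (continuousOn_const.mul (hh₀c.abs.rpow_const fun x _ => Or.inr (by linarith))).mul hh₀c
  have H : ∀ φ : EuclideanSpace ℝ (Fin N) → ℝ, ContDiff ℝ (⊤ : ℕ∞) φ → HasCompactSupport φ →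
      tsupport φ ⊆ Ω → ∫ x in Ω, fderiv ℝ φ x (X x) = ∫ x in Ω, g x * φ x := by
    intro φ hφ hφc hφs
    have hts : tsupport (fun x => (φ x : ℂ)) ⊆ tsupport φ :=
      closure_mono fun x hx => by simpa using hx
    have hder : ∀ x w, fderiv ℝ (fun x => (φ x : ℂ)) x w = (fderiv ℝ φ x w : ℂ) := by
      intro x w
      have h1 : HasFDerivAt φ (fderiv ℝ φ x) x := (hφ.differentiable (by simp) x).hasFDerivAt
      have h2 := (Complex.ofRealCLM.hasFDerivAt (x := φ x)).comp x h1
      have h3 : fderiv ℝ (fun x => (φ x : ℂ)) x = _ := h2.fderiv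
      rw [h3]
      rfl
    obtain ⟨-, -, h⟩ := heq (fun x => (φ x : ℂ)) (Complex.ofRealCLM.contDiff.comp hφ)
      (hφc.of_isClosed_subset (isClosed_tsupport _) hts) (hts.trans hφs)
    simp only [dirDeriv, dirDerivR] at h
    have e1 : ∀ x, fderiv ℝ φ x (X x) = (V x * |a x| ^ (p - 2) * a x) * fderiv ℝ φ x (v x) :=
      fun x => by simp [X]
    have e2 : ((∫ x in Ω, fderiv ℝ φ x (X x) : ℝ) : ℂ) = ((∫ x in Ω, g x * φ x : ℝ) : ℂ) := by
      rw [← integral_complex_ofReal, ← integral_complex_ofReal]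
      refine Eq.trans (integral_congr_ae (ae_of_all _ fun x => ?_))
        (h.trans (Eq.trans (integral_smul _ _).symm (integral_congr_ae (ae_of_all _ fun x => ?_))))
      · simp only [hder, e1]
        simp [a, v]
      · simp only [g, Complex.real_smul]
        push_cast
        ring
    exact_mod_cast e2
  -- the test function
  let φ : EuclideanSpace ℝ (Fin N) → ℝ := fun x => ‖u x‖ ^ p * (|h₀ x| ^ (-p) * h₀ x)
  have hφs : tsupport φ ⊆ tsupport u := by
    refine closure_mono fun x hx => ?_
    intro h
    apply hx
    simp [φ, h, hp0.ne']
  have hu1 : ContDiff ℝ 1 u := hu.of_le (by exact_mod_cast le_top)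
  have hφ : ContDiff ℝ 1 φ := by
    refine contDiff_iff_contDiffAt.2 fun x => ?_
    by_cases hx : x ∈ tsupport φ
    swap
    · exact contDiffAt_const.congr_of_eventuallyEq (notMem_tsupport_iff_eventuallyEq.1 hx)
    have hxΩ := hus (hφs hx)
    have hhx : ContDiffAt ℝ 1 h₀ x := hh₀.contDiffAt (hΩ.mem_nhds hxΩ)
    have hne := hh₀ne x hxΩ
    refine (hu1.norm_rpow (by linarith)).contDiffAt.mul (ContDiffAt.mul ?_ hhx)
    exact ((contDiffAt_abs hne).comp x hhx).rpow_const_of_ne (abs_ne_zero.2 hne)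
  have hdφ : ∀ x ∈ Ω, fderiv ℝ φ x (v x) =
      (p * ‖u x‖ ^ (p - 2) * inner ℝ (u x) (fderiv ℝ u x (v x))) * (|h₀ x| ^ (-p) * h₀ x) +
      ‖u x‖ ^ p * ((1 - p) * |h₀ x| ^ (-p) * a x) := by
    intro x hx
    have hne := hh₀ne x hx
    have h1 : HasFDerivAt h₀ (fderiv ℝ h₀ x) x :=
      ((hh₀.contDiffAt (hΩ.mem_nhds hx)).differentiableAt (by simp)).hasFDerivAt
    have h2 := (aux_deriv p (h₀ x) hne).comp_hasFDerivAt x h1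
    have h3 := (hasFDerivAt_norm_rpow (u x) (p := p) (by linarith)).comp x
      (hu1.differentiable (by simp) x).hasFDerivAt
    have h4 : fderiv ℝ φ x = _ := (h3.mul h2).fderiv
    rw [h4]
    simp [a]
    ring
  have hφc : HasCompactSupport φ := huc.of_isClosed_subset (isClosed_tsupport _) hφs
  obtain ⟨hi, hE⟩ := aux_extend hΩ X g hX hg H φ hφ hφc (hφs.trans hus)
  have hL : lam * ∫ x in Ω, W x * ‖u x‖ ^ p = ∫ x in Ω, g x * φ x := by
    rw [← integral_const_mul]
    refine setIntegral_congr_fun hΩm fun x hx => ?_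
    have hpos : 0 < |h₀ x| := abs_pos.2 (hh₀ne x hx)
    have : |h₀ x| ^ (p - 2) * (h₀ x * h₀ x) * |h₀ x| ^ (-p) = 1 := by
      rw [← abs_mul_abs_self, ← pow_two, ← rpow_natCast, ← rpow_add hpos, ← rpow_add hpos]
      norm_num
    simp only [g, φ]
    linear_combination (-(lam * W x * ‖u x‖ ^ p)) * this
  rw [hL, ← hE]
  have hdu : Continuous (fderiv ℝ u) := hu1.continuous_fderiv one_ne_zero
  have hR : IntegrableOn (fun x => V x * ‖fderiv ℝ u x (v x)‖ ^ p) Ω := by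
    refine aux_intOn (K := tsupport u) hΩ ?_ huc.isCompact hus ?_
    · refine aux_locInt hΩ (m := fun x => (‖fderiv ℝ u x‖ ^ p * ρ x ^ p) *
        (V x * ‖Z x‖ ^ p)) ?_ ?_ ?_
      · refine LocallyIntegrableOn.continuousOn_mul hVZ ?_ hΩ.isLocallyClosed
        refine ContinuousOn.mul (hdu.norm.continuousOn.rpow_const fun x _ => Or.inr hp0.le)
          (hρ.continuousOn.rpow_const fun x _ => Or.inr hp0.le)
      · refine hVmeas (fun x => ‖fderiv ℝ u x (v x)‖ ^ p) ?_ (fun x hx => by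
          simp [hv0 x hx, hp0.ne'])
        exact (Real.continuous_rpow_const hp0.le).comp_aestronglyMeasurable
          (happ _ hdu.continuousOn).norm
      · intro x hx
        have hVx := hV x hx
        rw [Real.norm_of_nonneg (by positivity)]
        calc V x * ‖fderiv ℝ u x (v x)‖ ^ p
            ≤ V x * (‖fderiv ℝ u x‖ * (ρ x * ‖Z x‖)) ^ p := by
              gcongr
              exact (fderiv ℝ u x).le_opNorm_of_le (hvρ x)
          _ = _ := by
              rw [mul_rpow (norm_nonneg _) (mul_nonneg (hρ0 x) (norm_nonneg _)),
                mul_rpow (hρ0 x) (norm_nonneg _)]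
              ring
    · intro x hx
      have : fderiv ℝ u x = 0 := image_eq_zero_of_notMem_tsupport
        (fun h => hx (tsupport_fderiv_subset ℝ h))
      simp [this, hp0.ne']
  refine setIntegral_mono_on hi hR hΩm fun x hx => ?_
  have hP := mul_le_mul_of_nonneg_left
    (aux_picone hp (a x) (h₀ x) (hh₀ne x hx) (u x) (fderiv ℝ u x (v x))) (hV x hx)
  refine le_trans (le_of_eq ?_) hP
  rw [← hdφ x hx]
  simp only [X, map_smul, smul_eq_mul]
  ring
end
end

section
/- Let Ω ⊆ ℝ^N be an open set, p ≥ 2 a real number, h ≥ 1 a natural number, and σ : ℝ^N → M_{h×N}(ℝ) a continuous matrix-valued function; write ∇_L u(x) := σ(x)∇u(x) ∈ ℂ^h. Let V, W : Ω → ℝ be locally integrable on Ω with V(x) ≥ 0 on Ω, and let λ > 0. Suppose there exists a real-valued C¹ function h₀ on Ω with h₀(x) ≠ 0 for every x ∈ Ω such that for every φ ∈ C^∞_c(Ω;ℂ): ∫_Ω V |∇_L h₀|^{p−2} ⟨∇_L h₀, ∇_L φ⟩ dx = λ ∫_Ω W |h₀|^{p−2} h₀ φ dx (both integrals being absolutely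 convergent), where ⟨·,·⟩ denotes the pairing Σ_i (∇_L h₀)_i (∇_L φ)_i. Then for every u ∈ C^∞_c(Ω;ℂ): ∫_Ω V(x) |∇_L u(x)|^p dx ≥ λ ∫_Ω W(x) |u(x)|^p dx. -/
open MeasureTheory Real

noncomputable section

/-- The horizontal gradient `∇_L u(x) = σ(x) ∇u(x) ∈ ℂ^h`:
its `i`-th component is the derivative of `u` along the `i`-th row of `σ(x)`. -/
def gradL {N hdim : ℕ} (σ : EuclideanSpace ℝ (Fin N) → Matrix (Fin hdim) (Fin N) ℝ)
    (u : EuclideanSpace ℝ (Fin N) → ℂ) (x : EuclideanSpace ℝ (Fin N)) : Fin hdim → ℂ :=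
  fun i => dirDeriv u x (fun j => σ x i j)

/-- Real-valued version of `gradL`. -/
def gradLR {N hdim : ℕ} (σ : EuclideanSpace ℝ (Fin N) → Matrix (Fin hdim) (Fin N) ℝ)
    (u : EuclideanSpace ℝ (Fin N) → ℝ) (x : EuclideanSpace ℝ (Fin N)) : Fin hdim → ℝ :=
  fun i => dirDerivR u x (fun j => σ x i j)

/-- The hermitian (Euclidean) norm on `ℂ^h`. -/
def hNorm {hdim : ℕ} (F : Fin hdim → ℂ) : ℝ :=
  Real.sqrt (∑ i, ‖F i‖ ^ 2)


lemma young_aux {p : ℝ} (hp : 2 ≤ p) {A t : ℝ} (hA : 0 ≤ A) (ht : 0 ≤ t) :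
    p * t ^ (p - 1) * A - (p - 1) * t ^ p ≤ A ^ p := by
  have hp1 : 1 < p := by linarith
  have hc := Real.HolderConjugate.conjExponent hp1
  have h := Real.young_inequality_of_nonneg hA (Real.rpow_nonneg ht (p - 1)) hc
  rw [← Real.rpow_mul ht] at h
  have e : (p - 1) * p.conjExponent = p := by
    unfold Real.conjExponent
    have : p - 1 ≠ 0 := by linarith
    field_simp
  rw [e] at h
  have e2 : t ^ p / p.conjExponent = (p - 1) * t ^ p / p := by
    unfold Real.conjExponent
    have : p - 1 ≠ 0 := by linarith
    field_simp
  rw [e2, ← add_div, le_div_iff₀ (by linarith)] at h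
  linarith

lemma picone_aux {n : ℕ} {p : ℝ} (hp : 2 ≤ p) (a : Fin n → ℂ) (b : Fin n → ℝ) (q : ℂ) :
    hNorm (fun i => (b i : ℂ)) ^ (p - 2) *
      ∑ i, b i * (p * ‖q‖ ^ (p - 2) * inner ℝ q (a i) - (p - 1) * ‖q‖ ^ p * b i)
      ≤ hNorm a ^ p := by
  set B := hNorm (fun i => (b i : ℂ)) with hB
  set A := hNorm a with hA
  have hB0 : 0 ≤ B := Real.sqrt_nonneg _
  have hA0 : 0 ≤ A := Real.sqrt_nonneg _
  have hBs : B ^ 2 = ∑ i, b i ^ 2 := by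
    rw [hB, hNorm, Real.sq_sqrt (Finset.sum_nonneg fun i _ => by positivity)]
    simp
  have h1 : ∑ i, b i * inner ℝ q (a i) ≤ ‖q‖ * (B * A) := by
    calc ∑ i, b i * inner ℝ q (a i) ≤ ∑ i, ‖q‖ * (‖(b i : ℂ)‖ * ‖a i‖) := by
          refine Finset.sum_le_sum fun i _ => ?_
          refine (le_abs_self _).trans ?_
          rw [abs_mul, Complex.norm_real, Real.norm_eq_abs]
          have := abs_real_inner_le_norm q (a i)
          calc _ ≤ |b i| * (‖q‖ * ‖a i‖) := by gcongr
            _ = _ := by ring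
      _ = ‖q‖ * ∑ i, ‖(b i : ℂ)‖ * ‖a i‖ := by rw [Finset.mul_sum]
      _ ≤ _ := by
          gcongr
          exact Real.sum_mul_le_sqrt_mul_sqrt _ _ _
  have h2 : ∑ i, b i * (p * ‖q‖ ^ (p - 2) * inner ℝ q (a i) - (p - 1) * ‖q‖ ^ p * b i)
      = p * ‖q‖ ^ (p - 2) * ∑ i, b i * inner ℝ q (a i) - (p - 1) * ‖q‖ ^ p * B ^ 2 := by
    rw [hBs, Finset.mul_sum, Finset.mul_sum, ← Finset.sum_sub_distrib]
    exact Finset.sum_congr rfl fun i _ => by ring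
  have e1 : ∀ x : ℝ, 0 ≤ x → x ^ (p - 1) = x ^ (p - 2) * x := by
    intro x hx
    rw [show p - 1 = (p - 2) + 1 by ring, Real.rpow_add_of_nonneg hx (by linarith) (by norm_num),
      Real.rpow_one]
  have e2 : ∀ x : ℝ, 0 ≤ x → x ^ p = x ^ (p - 2) * x ^ 2 := by
    intro x hx
    rw [← Real.rpow_natCast x 2, ← Real.rpow_add_of_nonneg hx (by linarith) (by norm_num)]
    congr 1; push_cast; ring
  have hy := young_aux hp hA0 (mul_nonneg (norm_nonneg q) hB0)
  rw [Real.mul_rpow (norm_nonneg q) hB0, Real.mul_rpow (norm_nonneg q) hB0, e1 B hB0,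
    e1 _ (norm_nonneg q), e2 B hB0] at hy
  rw [h2]
  refine le_trans ?_ hy
  have : B ^ (p - 2) * (p * ‖q‖ ^ (p - 2) * ∑ i, b i * inner ℝ q (a i)) ≤
     B ^ (p - 2) * (p * ‖q‖ ^ (p - 2) * (‖q‖ * (B * A))) := by
    have : 0 ≤ p := by linarith
    gcongr
  linarith

open scoped Convolution in
lemma approx_aux {N : ℕ} {Ω : Set (EuclideanSpace ℝ (Fin N))} (hΩ : IsOpen Ω)
    (φ : EuclideanSpace ℝ (Fin N) → ℂ) (hφ : ContDiff ℝ 1 φ) (hc : HasCompactSupport φ)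
    (hs : tsupport φ ⊆ Ω) :
    ∃ K : Set (EuclideanSpace ℝ (Fin N)), IsCompact K ∧ K ⊆ Ω ∧ tsupport φ ⊆ K ∧
      ∀ ε : ℝ, 0 < ε → ∃ ψ : EuclideanSpace ℝ (Fin N) → ℂ,
        ContDiff ℝ (⊤ : ℕ∞) ψ ∧ HasCompactSupport ψ ∧ tsupport ψ ⊆ K ∧
        (∀ x, ‖ψ x - φ x‖ ≤ ε) ∧ (∀ x, ‖fderiv ℝ ψ x - fderiv ℝ φ x‖ ≤ ε) := by
  obtain ⟨δ, hδ, hK⟩ := IsCompact.exists_cthickening_subset_open hc hΩ hs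
  have hKc : IsCompact (Metric.cthickening δ (tsupport φ)) := IsCompact.cthickening hc
  refine ⟨Metric.cthickening δ (tsupport φ), hKc, hK,
    Metric.self_subset_cthickening _, fun ε hε => ?_⟩
  have hcont' : Continuous (fderiv ℝ φ) := hφ.continuous_fderiv one_ne_zero
  have hu1 := Metric.uniformContinuous_iff.1 (hc.uniformContinuous_of_continuous hφ.continuous) ε hε
  have hu2 := Metric.uniformContinuous_iff.1
    ((hc.fderiv ℝ).uniformContinuous_of_continuous hcont') ε hε
  obtain ⟨δ₁, hδ₁, h1⟩ := hu1
  obtain ⟨δ₂, hδ₂, h2⟩ := hu2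
  set r := min δ (min δ₁ δ₂) with hr
  have hr0 : 0 < r := lt_min hδ (lt_min hδ₁ hδ₂)
  let ρ : ContDiffBump (0 : EuclideanSpace ℝ (Fin N)) := ⟨r / 2, r, by linarith, by linarith⟩
  have hρr : ρ.rOut = r := rfl
  have hρc : HasCompactSupport (ρ.normed volume) := ρ.hasCompactSupport_normed
  have hρs : ContDiff ℝ (⊤ : ℕ∞) (ρ.normed volume) := ρ.contDiff_normed
  have hsub : tsupport (ρ.normed volume ⋆[ContinuousLinearMap.lsmul ℝ ℝ, volume] φ) ⊆
      Metric.cthickening δ (tsupport φ) := by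
    refine closure_minimal ?_ Metric.isClosed_cthickening
    refine (support_convolution_subset _).trans ?_
    rw [ρ.support_normed_eq]
    rintro _ ⟨a, ha, b, hb, rfl⟩
    refine Metric.mem_cthickening_of_dist_le _ b _ _ (subset_tsupport _ hb) ?_
    simp only [hρr, mem_ball_zero_iff] at ha ⊢
    simpa using ha.le.trans (min_le_left _ _)
  refine ⟨ρ.normed volume ⋆[ContinuousLinearMap.lsmul ℝ ℝ, volume] φ, ?_, ?_, hsub, ?_, ?_⟩
  · exact hρc.contDiff_convolution_left _ hρs hφ.continuous.locallyIntegrable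
  · exact hKc.of_isClosed_subset (isClosed_tsupport _) hsub
  · intro x
    rw [← dist_eq_norm]
    refine ρ.dist_normed_convolution_le hφ.continuous.aestronglyMeasurable fun y hy => ?_
    exact (h1 (lt_of_lt_of_le hy ((min_le_right _ _).trans (min_le_left _ _)))).le
  · intro x
    have hd := hc.hasFDerivAt_convolution_right (ContinuousLinearMap.lsmul ℝ ℝ)
      (hρs.continuous.locallyIntegrable (μ := volume)) hφ x
    rw [hd.fderiv, ← dist_eq_norm]
    have := ρ.dist_normed_convolution_le (μ := volume) (x₀ := x) (ε := ε)
      hcont'.aestronglyMeasurable fun y hy =>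
      (h2 (lt_of_lt_of_le hy ((min_le_right _ _).trans (min_le_right _ _)))).le
    exact this

lemma gradL_zero_of_notMem {N hdim : ℕ} (σ : EuclideanSpace ℝ (Fin N) → Matrix (Fin hdim) (Fin N) ℝ)
    {φ : EuclideanSpace ℝ (Fin N) → ℂ} {K : Set (EuclideanSpace ℝ (Fin N))}
    (hK : tsupport φ ⊆ K) {x : EuclideanSpace ℝ (Fin N)} (hx : x ∉ K) (i : Fin hdim) :
    gradL σ φ x i = 0 := by
  have : fderiv ℝ φ x = 0 := by
    by_contra h
    exact hx (hK (support_fderiv_subset ℝ h))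
  simp [gradL, dirDeriv, this]

def rowL {N hdim : ℕ} (σ : EuclideanSpace ℝ (Fin N) → Matrix (Fin hdim) (Fin N) ℝ)
    (i : Fin hdim) (x : EuclideanSpace ℝ (Fin N)) : EuclideanSpace ℝ (Fin N) :=
  (WithLp.equiv 2 (Fin N → ℝ)).symm (fun j => σ x i j)

lemma continuous_rowL {N hdim : ℕ} {σ : EuclideanSpace ℝ (Fin N) → Matrix (Fin hdim) (Fin N) ℝ}
    (hσ : Continuous σ) (i : Fin hdim) : Continuous (rowL σ i) := by
  unfold rowL
  refine (PiLp.continuous_toLp 2 _).comp ?_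
  exact continuous_pi fun j => hσ.matrix_elem i j

lemma gradL_eq {N hdim : ℕ} (σ : EuclideanSpace ℝ (Fin N) → Matrix (Fin hdim) (Fin N) ℝ)
    (u : EuclideanSpace ℝ (Fin N) → ℂ) (x : EuclideanSpace ℝ (Fin N)) (i : Fin hdim) :
    gradL σ u x i = fderiv ℝ u x (rowL σ i x) := rfl

lemma gradLR_eq {N hdim : ℕ} (σ : EuclideanSpace ℝ (Fin N) → Matrix (Fin hdim) (Fin N) ℝ)
    (u : EuclideanSpace ℝ (Fin N) → ℝ) (x : EuclideanSpace ℝ (Fin N)) (i : Fin hdim) :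
    gradLR σ u x i = fderiv ℝ u x (rowL σ i x) := rfl

open Filter Topology in
lemma weak_ext {N hdim : ℕ}
    {Ω : Set (EuclideanSpace ℝ (Fin N))} (hΩ : IsOpen Ω)
    (σ : EuclideanSpace ℝ (Fin N) → Matrix (Fin hdim) (Fin N) ℝ)
    (hσ : Continuous σ)
    (V W : EuclideanSpace ℝ (Fin N) → ℝ)
    (hVloc : LocallyIntegrableOn V Ω volume)
    (hW : LocallyIntegrableOn W Ω volume)
    (lam : ℝ)
    (A B : EuclideanSpace ℝ (Fin N) → ℝ) (G : EuclideanSpace ℝ (Fin N) → Fin hdim → ℝ)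
    (hA : ContinuousOn A Ω) (hB : ContinuousOn B Ω) (hG : ∀ i, ContinuousOn (fun x => G x i) Ω)
    (heq : ∀ φ : EuclideanSpace ℝ (Fin N) → ℂ,
      ContDiff ℝ (⊤ : ℕ∞) φ → HasCompactSupport φ → tsupport φ ⊆ Ω →
      IntegrableOn (fun x => (V x * A x) • ∑ i, ((G x i : ℝ) : ℂ) * gradL σ φ x i) Ω volume ∧
      IntegrableOn (fun x => (W x * B x) • φ x) Ω volume ∧
      ∫ x in Ω, (V x * A x) • ∑ i, ((G x i : ℝ) : ℂ) * gradL σ φ x i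
        = lam • ∫ x in Ω, (W x * B x) • φ x)
    (φ : EuclideanSpace ℝ (Fin N) → ℂ) (hφ : ContDiff ℝ 1 φ) (hc : HasCompactSupport φ)
    (hs : tsupport φ ⊆ Ω) :
    ∫ x in Ω, (V x * A x) • ∑ i, ((G x i : ℝ) : ℂ) * gradL σ φ x i
        = lam • ∫ x in Ω, (W x * B x) • φ x := by
  obtain ⟨K, hK, hKΩ, hφK, happ⟩ := approx_aux hΩ φ hφ hc hs
  have hpos : ∀ n : ℕ, (0 : ℝ) < 1 / ((n : ℝ) + 1) := fun n => by positivity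
  have hle : ∀ n : ℕ, 1 / ((n : ℝ) + 1) ≤ 1 := fun n => by
    rw [div_le_one (by positivity)]; linarith [Nat.cast_nonneg (α := ℝ) n]
  choose ψ hψ1 hψ2 hψ3 hψ4 hψ5 using fun n : ℕ => happ _ (hpos n)
  have red1 : ∀ f : EuclideanSpace ℝ (Fin N) → ℂ, tsupport f ⊆ K →
      ∫ x in Ω, (V x * A x) • ∑ i, ((G x i : ℝ) : ℂ) * gradL σ f x i =
      ∫ x in K, (V x * A x) • ∑ i, ((G x i : ℝ) : ℂ) * gradL σ f x i := by
    intro f hf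
    refine setIntegral_eq_of_subset_of_forall_sdiff_eq_zero hΩ.measurableSet hKΩ fun x hx => ?_
    simp [gradL_zero_of_notMem σ hf hx.2]
  have red2 : ∀ f : EuclideanSpace ℝ (Fin N) → ℂ, tsupport f ⊆ K →
      ∫ x in Ω, (W x * B x) • f x = ∫ x in K, (W x * B x) • f x := by
    intro f hf
    refine setIntegral_eq_of_subset_of_forall_sdiff_eq_zero hΩ.measurableSet hKΩ fun x hx => ?_
    rw [image_eq_zero_of_notMem_tsupport (fun h => hx.2 (hf h)), smul_zero]
  rw [red1 φ hφK, red2 φ hφK]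
  have hlim : Tendsto (fun n : ℕ => 1 / ((n : ℝ) + 1)) atTop (𝓝 0) :=
    tendsto_one_div_add_atTop_nhds_zero_nat
  have ht1 : ∀ x, Tendsto (fun n => ψ n x) atTop (𝓝 (φ x)) := fun x => by
    rw [tendsto_iff_norm_sub_tendsto_zero]
    exact squeeze_zero (fun _ => norm_nonneg _) (fun n => hψ4 n x) hlim
  have ht2 : ∀ x, Tendsto (fun n => fderiv ℝ (ψ n) x) atTop (𝓝 (fderiv ℝ φ x)) := fun x => by
    rw [tendsto_iff_norm_sub_tendsto_zero]
    exact squeeze_zero (fun _ => norm_nonneg _) (fun n => hψ5 n x) hlim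
  obtain ⟨C1, hC1⟩ := hc.exists_bound_of_continuous hφ.continuous
  obtain ⟨C2, hC2⟩ := (hc.fderiv ℝ).exists_bound_of_continuous (hφ.continuous_fderiv one_ne_zero)
  have hb1 : ∀ n x, ‖ψ n x‖ ≤ C1 + 1 := fun n x => by
    have := norm_le_norm_add_norm_sub (φ x) (ψ n x)
    have h3 := hψ4 n x
    rw [norm_sub_rev] at h3
    linarith [hC1 x, hle n]
  have hb2 : ∀ n x, ‖fderiv ℝ (ψ n) x‖ ≤ C2 + 1 := fun n x => by
    have := norm_le_norm_add_norm_sub (fderiv ℝ φ x) (fderiv ℝ (ψ n) x)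
    have h3 := hψ5 n x
    rw [norm_sub_rev] at h3
    linarith [hC2 x, hle n]
  have hVK : IntegrableOn V K volume := hVloc.integrableOn_compact_subset hKΩ hK
  have hWK : IntegrableOn W K volume := hW.integrableOn_compact_subset hKΩ hK
  have L1 : Tendsto (fun n => ∫ x in K, (V x * A x) • ∑ i, ((G x i : ℝ) : ℂ) * gradL σ (ψ n) x i)
      atTop (𝓝 (∫ x in K, (V x * A x) • ∑ i, ((G x i : ℝ) : ℂ) * gradL σ φ x i)) := by
    refine tendsto_integral_of_dominated_convergence
      (fun x => ‖V x‖ * (‖A x‖ * ∑ i, ‖G x i‖ * ((C2 + 1) * ‖rowL σ i x‖))) ?_ ?_ ?_ ?_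
    · intro n
      exact ((heq (ψ n) (hψ1 n) (hψ2 n) ((hψ3 n).trans hKΩ)).1.mono_set hKΩ).aestronglyMeasurable
    · refine IntegrableOn.mul_continuousOn hVK.norm ?_ hK
      refine (hA.mono hKΩ).norm.mul (continuousOn_finsetSum _ fun i _ => ?_)
      exact ((hG i).mono hKΩ).norm.mul
        (continuousOn_const.mul (continuous_rowL hσ i).norm.continuousOn)
    · intro n
      refine Eventually.of_forall fun x => ?_
      rw [norm_smul, norm_mul, mul_assoc]
      gcongr
      refine (norm_sum_le _ _).trans (Finset.sum_le_sum fun i _ => ?_)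
      rw [norm_mul, Complex.norm_real, gradL_eq]
      gcongr
      exact (ContinuousLinearMap.le_opNorm _ _).trans (by gcongr; exact hb2 n x)
    · refine Eventually.of_forall fun x => ?_
      refine Tendsto.const_smul (tendsto_finsetSum _ fun i _ => ?_) _
      refine Tendsto.const_mul _ ?_
      simp only [gradL_eq]
      exact ((ContinuousLinearMap.apply ℝ ℂ (rowL σ i x)).continuous.tendsto _).comp (ht2 x)
  have L2 : Tendsto (fun n => ∫ x in K, (W x * B x) • ψ n x)
      atTop (𝓝 (∫ x in K, (W x * B x) • φ x)) := by
    refine tendsto_integral_of_dominated_convergence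
      (fun x => ‖W x‖ * (‖B x‖ * (C1 + 1))) ?_ ?_ ?_ ?_
    · intro n
      exact ((heq (ψ n) (hψ1 n) (hψ2 n) ((hψ3 n).trans hKΩ)).2.1.mono_set hKΩ).aestronglyMeasurable
    · refine IntegrableOn.mul_continuousOn hWK.norm ?_ hK
      exact (hB.mono hKΩ).norm.mul continuousOn_const
    · intro n
      refine Eventually.of_forall fun x => ?_
      rw [norm_smul, norm_mul, mul_assoc]
      gcongr
      exact hb1 n x
    · exact Eventually.of_forall fun x => (ht1 x).const_smul _
  refine tendsto_nhds_unique L1 ?_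
  refine (L2.const_smul lam).congr fun n => ?_
  rw [← red1 _ (hψ3 n), ← red2 _ (hψ3 n)]
  exact (heq (ψ n) (hψ1 n) (hψ2 n) ((hψ3 n).trans hKΩ)).2.2.symm

lemma test_contDiffAt {N : ℕ} {p : ℝ} (hp : 2 ≤ p) {v : EuclideanSpace ℝ (Fin N) → ℝ}
    {u : EuclideanSpace ℝ (Fin N) → ℂ} {x : EuclideanSpace ℝ (Fin N)}
    (hv : ContDiffAt ℝ 1 v x) (hu : ContDiffAt ℝ 1 u x) (hx : v x ≠ 0) :
    ContDiffAt ℝ 1 (fun y => v y * ‖(v y)⁻¹ • u y‖ ^ p) x := by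
  have h := (contDiff_norm_rpow (E := ℂ) (p := p) (by linarith)).contDiffAt.comp x
    ((hv.inv hx).smul hu)
  exact hv.mul h

lemma test_fderiv {N : ℕ} {p : ℝ} (hp : 2 ≤ p) {v : EuclideanSpace ℝ (Fin N) → ℝ}
    {u : EuclideanSpace ℝ (Fin N) → ℂ} {x : EuclideanSpace ℝ (Fin N)}
    (hv : DifferentiableAt ℝ v x) (hu : DifferentiableAt ℝ u x) (hx : v x ≠ 0)
    (w : EuclideanSpace ℝ (Fin N)) :
    fderiv ℝ (fun y => v y * ‖(v y)⁻¹ • u y‖ ^ p) x w =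
      p * ‖(v x)⁻¹ • u x‖ ^ (p - 2) * inner ℝ ((v x)⁻¹ • u x) (fderiv ℝ u x w)
        - (p - 1) * ‖(v x)⁻¹ • u x‖ ^ p * fderiv ℝ v x w := by
  have hq : DifferentiableAt ℝ (fun y => (v y)⁻¹ • u y) x := (hv.inv hx).smul hu
  set q := fun y => (v y)⁻¹ • u y with hqdef
  have hu' : fderiv ℝ u x w = v x • fderiv ℝ q x w + fderiv ℝ v x w • q x := by
    have h1 := hv.hasFDerivAt.smul hq.hasFDerivAt
    have h2 : HasFDerivAt u (v x • fderiv ℝ q x + (fderiv ℝ v x).smulRight (q x)) x := by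
      refine h1.congr_of_eventuallyEq ?_
      filter_upwards [hv.continuousAt.eventually_ne hx] with y hy
      change u y = v y • (v y)⁻¹ • u y
      rw [smul_smul, mul_inv_cancel₀ hy, one_smul]
    rw [h2.fderiv]
    simp
  have hN : HasFDerivAt (fun y => ‖q y‖ ^ p) _ x :=
    (hasFDerivAt_norm_rpow (q x) (p := p) (by linarith)).comp x hq.hasFDerivAt
  have hm := (hv.hasFDerivAt.mul hN).fderiv
  have e2 : ‖q x‖ ^ p = ‖q x‖ ^ (p - 2) * ‖q x‖ ^ 2 := by
    rw [← Real.rpow_natCast ‖q x‖ 2,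
      ← Real.rpow_add_of_nonneg (norm_nonneg _) (by linarith) (by norm_num)]
    congr 1; push_cast; ring
  change fderiv ℝ (fun y => v y * ‖q y‖ ^ p) x w = p * ‖q x‖ ^ (p - 2) *
    inner ℝ (q x) (fderiv ℝ u x w) - (p - 1) * ‖q x‖ ^ p * fderiv ℝ v x w
  have hm' : fderiv ℝ (fun y => v y * ‖q y‖ ^ p) x = _ := hm
  rw [hm', hu', inner_add_right, real_inner_smul_right, real_inner_smul_right,
    real_inner_self_eq_norm_sq]
  simp only [add_apply, smul_apply,
    ContinuousLinearMap.comp_apply, innerSL_apply_apply, smul_eq_mul]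
  rw [e2]
  ring

/-- **Complete Hardy-type inequality** for the horizontal gradient `∇_L u = σ ∇u`. -/
theorem hardy_complete
    {N hdim : ℕ} (hhdim : 1 ≤ hdim)
    {p : ℝ} (hp : 2 ≤ p)
    {Ω : Set (EuclideanSpace ℝ (Fin N))} (hΩ : IsOpen Ω)
    (σ : EuclideanSpace ℝ (Fin N) → Matrix (Fin hdim) (Fin N) ℝ)
    (hσ : Continuous σ)
    (V W : EuclideanSpace ℝ (Fin N) → ℝ)
    (hV : ∀ x ∈ Ω, 0 ≤ V x)
    (hVloc : LocallyIntegrableOn V Ω volume)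
    (hW : LocallyIntegrableOn W Ω volume)
    {lam : ℝ} (hlam : 0 < lam)
    (h₀ : EuclideanSpace ℝ (Fin N) → ℝ)
    (hh₀ : ContDiffOn ℝ 1 h₀ Ω)
    (hh₀ne : ∀ x ∈ Ω, h₀ x ≠ 0)
    (heq : ∀ φ : EuclideanSpace ℝ (Fin N) → ℂ,
      ContDiff ℝ (⊤ : ℕ∞) φ → HasCompactSupport φ → tsupport φ ⊆ Ω →
      IntegrableOn (fun x =>
        (V x * hNorm (fun i => ((gradLR σ h₀ x i : ℝ) : ℂ)) ^ (p - 2)) •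
          ∑ i, ((gradLR σ h₀ x i : ℝ) : ℂ) * gradL σ φ x i) Ω volume ∧
      IntegrableOn (fun x => (W x * |h₀ x| ^ (p - 2) * h₀ x) • φ x) Ω volume ∧
      ∫ x in Ω,
          (V x * hNorm (fun i => ((gradLR σ h₀ x i : ℝ) : ℂ)) ^ (p - 2)) •
            ∑ i, ((gradLR σ h₀ x i : ℝ) : ℂ) * gradL σ φ x i
        = lam • ∫ x in Ω, (W x * |h₀ x| ^ (p - 2) * h₀ x) • φ x) :
    ∀ u : EuclideanSpace ℝ (Fin N) → ℂ,
      ContDiff ℝ (⊤ : ℕ∞) u → HasCompactSupport u → tsupport u ⊆ Ω →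
      lam * ∫ x in Ω, W x * ‖u x‖ ^ p
        ≤ ∫ x in Ω, V x * hNorm (gradL σ u x) ^ p := by
  intro u hu huc hus
  have hu1 : ContDiff ℝ 1 u := hu.of_le (by exact_mod_cast le_top)
  have hvat : ∀ x ∈ Ω, ContDiffAt ℝ 1 h₀ x := fun x hx => hh₀.contDiffAt (hΩ.mem_nhds hx)
  have hp0 : p ≠ 0 := by linarith
  have hp2 : 0 ≤ p - 2 := by linarith
  set Φr : EuclideanSpace ℝ (Fin N) → ℝ := fun y => h₀ y * ‖(h₀ y)⁻¹ • u y‖ ^ p with hΦr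
  set Φ : EuclideanSpace ℝ (Fin N) → ℂ := fun y => (Φr y : ℂ) with hΦ
  have hsupp : Function.support Φ ⊆ Function.support u := by
    intro x hx hux
    apply hx
    simp [hΦ, hΦr, hux, Real.zero_rpow hp0]
  have htsupp : tsupport Φ ⊆ tsupport u := closure_mono hsupp
  have hΦc : HasCompactSupport Φ :=
    IsCompact.of_isClosed_subset huc (isClosed_tsupport _) htsupp
  have hΦrd : ∀ x ∈ Ω, ContDiffAt ℝ 1 Φr x := fun x hx =>
    test_contDiffAt hp (hvat x hx) hu1.contDiffAt (hh₀ne x hx)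
  have hΦd : ContDiff ℝ 1 Φ := by
    rw [contDiff_iff_contDiffAt]
    intro x
    by_cases hx : x ∈ Ω
    · exact Complex.ofRealCLM.contDiff.contDiffAt.comp x (hΦrd x hx)
    · have : x ∉ tsupport Φ := fun h => hx (hus (htsupp h))
      rw [notMem_tsupport_iff_eventuallyEq] at this
      exact (contDiffAt_const (c := (0 : ℂ))).congr_of_eventuallyEq this
  -- continuity of coefficients
  have hv'c : ContinuousOn (fderiv ℝ h₀) Ω := hh₀.continuousOn_fderiv_of_isOpen hΩ le_rfl
  have hG : ∀ i, ContinuousOn (fun x => gradLR σ h₀ x i) Ω := fun i => by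
    simp only [gradLR_eq]
    exact hv'c.clm_apply (continuous_rowL hσ i).continuousOn
  have hA : ContinuousOn (fun x => hNorm (fun i => ((gradLR σ h₀ x i : ℝ) : ℂ)) ^ (p - 2)) Ω := by
    refine ContinuousOn.rpow_const ?_ fun x _ => Or.inr hp2
    unfold hNorm
    refine ContinuousOn.sqrt (continuousOn_finsetSum _ fun i _ => ?_)
    exact (Complex.continuous_ofReal.comp_continuousOn (hG i)).norm.pow 2
  have hB : ContinuousOn (fun x => |h₀ x| ^ (p - 2) * h₀ x) Ω :=
    (hh₀.continuousOn.abs.rpow_const fun x _ => Or.inr hp2).mul hh₀.continuousOn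
  simp only [mul_assoc (W _)] at heq
  have key := weak_ext hΩ σ hσ V W hVloc hW lam _ _ _ hA hB hG heq Φ hΦd hΦc (htsupp.trans hus)
  have hgrad : ∀ x ∈ Ω, ∀ i, gradL σ Φ x i = ((fderiv ℝ Φr x (rowL σ i x) : ℝ) : ℂ) := by
    intro x hx i
    have hd := ((hΦrd x hx).differentiableAt one_ne_zero).hasFDerivAt
    have h2 : HasFDerivAt Φ (Complex.ofRealCLM.comp (fderiv ℝ Φr x)) x :=
      Complex.ofRealCLM.hasFDerivAt.comp x hd
    rw [gradL_eq, h2.fderiv]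
    rfl
  set P : EuclideanSpace ℝ (Fin N) → ℝ := fun x =>
    hNorm (fun i => ((gradLR σ h₀ x i : ℝ) : ℂ)) ^ (p - 2) *
      ∑ i, gradLR σ h₀ x i * fderiv ℝ Φr x (rowL σ i x) with hP
  have k1 : ∫ x in Ω, (V x * hNorm (fun i => ((gradLR σ h₀ x i : ℝ) : ℂ)) ^ (p - 2)) •
            ∑ i, ((gradLR σ h₀ x i : ℝ) : ℂ) * gradL σ Φ x i
      = ((∫ x in Ω, V x * P x : ℝ) : ℂ) := by
    rw [← integral_complex_ofReal]
    refine setIntegral_congr_fun hΩ.measurableSet fun x hx => ?_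
    simp only [hgrad x hx, hP]
    rw [Complex.real_smul]
    push_cast
    ring
  have k2 : ∫ x in Ω, (W x * (|h₀ x| ^ (p - 2) * h₀ x)) • Φ x
      = ((∫ x in Ω, W x * ‖u x‖ ^ p : ℝ) : ℂ) := by
    rw [← integral_complex_ofReal]
    refine setIntegral_congr_fun hΩ.measurableSet fun x hx => ?_
    simp only [hΦ, hΦr]
    rw [Complex.real_smul, ← Complex.ofReal_mul]
    congr 1
    have h0 : 0 < |h₀ x| := abs_pos.2 (hh₀ne x hx)
    have e2 : |h₀ x| ^ (p - 2) * (h₀ x * h₀ x) = |h₀ x| ^ p := by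
      rw [← abs_mul_abs_self, ← sq, ← Real.rpow_natCast _ 2, ← Real.rpow_add h0]
      congr 1; push_cast; ring
    rw [norm_smul, norm_inv, Real.norm_eq_abs, Real.mul_rpow (by positivity) (norm_nonneg _),
      Real.inv_rpow h0.le]
    have h3 : |h₀ x| ^ p ≠ 0 := (Real.rpow_pos_of_pos h0 p).ne'
    calc _ = W x * (|h₀ x| ^ (p - 2) * (h₀ x * h₀ x)) * ((|h₀ x| ^ p)⁻¹ * ‖u x‖ ^ p) := by ring
      _ = _ := by rw [e2]; field_simp
  rw [k1, k2, Complex.real_smul, ← Complex.ofReal_mul, Complex.ofReal_inj] at key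
  rw [← key]
  -- everything lives on the compact set `tsupport u`
  have hK : IsCompact (tsupport u) := huc
  have hVK : IntegrableOn V (tsupport u) volume := hVloc.integrableOn_compact_subset hus hK
  have hPc : ContinuousOn P Ω := by
    refine hA.mul (continuousOn_finsetSum _ fun i _ => (hG i).mul ?_)
    have : ContinuousOn (fderiv ℝ Φr) Ω :=
      ContDiffOn.continuousOn_fderiv_of_isOpen (n := 1)
        (fun x hx => (hΦrd x hx).contDiffWithinAt) hΩ le_rfl
    exact this.clm_apply (continuous_rowL hσ i).continuousOn
  have hQc : Continuous (fun x => hNorm (gradL σ u x) ^ p) := by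
    refine Continuous.rpow_const ?_ fun x => Or.inr (by linarith)
    unfold hNorm
    refine Continuous.sqrt (continuous_finsetSum _ fun i _ => ?_)
    simp only [gradL_eq]
    exact (((hu1.continuous_fderiv one_ne_zero).clm_apply (continuous_rowL hσ i)).norm).pow 2
  have hPz : ∀ x ∈ Ω \ tsupport u, V x * P x = 0 := by
    intro x hx
    have : ∀ i, fderiv ℝ Φr x (rowL σ i x) = 0 := fun i => by
      have h := hgrad x hx.1 i
      rw [gradL_zero_of_notMem σ htsupp hx.2] at h
      exact_mod_cast h.symm
    simp [hP, this]
  have hQz : ∀ x ∈ Ω \ tsupport u, V x * hNorm (gradL σ u x) ^ p = 0 := by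
    intro x hx
    simp [hNorm, gradL_zero_of_notMem σ subset_rfl hx.2, Real.zero_rpow hp0]
  have hI1 : IntegrableOn (fun x => V x * P x) Ω volume :=
    (hVK.mul_continuousOn (hPc.mono hus) hK).of_forall_sdiff_eq_zero hΩ.measurableSet hPz
  have hI2 : IntegrableOn (fun x => V x * hNorm (gradL σ u x) ^ p) Ω volume :=
    (hVK.mul_continuousOn hQc.continuousOn hK).of_forall_sdiff_eq_zero hΩ.measurableSet hQz
  refine setIntegral_mono_on hI1 hI2 hΩ.measurableSet fun x hx => ?_
  refine mul_le_mul_of_nonneg_left ?_ (hV x hx)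
  have hfd : ∀ i, fderiv ℝ Φr x (rowL σ i x) = _ := fun i =>
    test_fderiv hp ((hvat x hx).differentiableAt one_ne_zero)
      (hu1.contDiffAt.differentiableAt one_ne_zero) (hh₀ne x hx) (rowL σ i x)
  simp only [hP, hfd]
  exact picone_aux hp (gradL σ u x) (gradLR σ h₀ x) ((h₀ x)⁻¹ • u x)
end
end

section
/- Let N ≥ 1, let p ≥ 2 be a real number, let θ ∈ ℝ, and let Ω ⊆ ℝ^N \ {0} be an open set. Then for every u ∈ C^∞_c(Ω;ℂ): ∫_Ω |∇u(x)·(x/|x|)|^p |x|^{−p(θ−1)} dx ≥ |(N − pθ)/p|^p ∫_Ω |u(x)|^p |x|^{−pθ} dx. -/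
open MeasureTheory Real

noncomputable section

theorem hardy_euler {N : ℕ} (g : EuclideanSpace ℝ (Fin N) → ℝ) (hg : ContDiff ℝ 1 g)
    (hc : HasCompactSupport g) :
    Integrable (fun x => fderiv ℝ g x x) ∧
    ∫ x, fderiv ℝ g x x = -(N : ℝ) * ∫ x, g x := by
  have hfd : Continuous (fderiv ℝ g) := hg.continuous_fderiv (by simp)
  have hcfd : HasCompactSupport (fderiv ℝ g) := hc.fderiv ℝ
  let L : Fin N → (EuclideanSpace ℝ (Fin N) →L[ℝ] ℝ) := fun i => EuclideanSpace.proj i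
  let e : Fin N → EuclideanSpace ℝ (Fin N) := fun i => EuclideanSpace.single i 1
  have hint : ∀ i, Integrable (fun x => L i x * fderiv ℝ g x (e i)) := by
    intro i
    apply Continuous.integrable_of_hasCompactSupport
    · exact (L i).continuous.mul (hfd.clm_apply continuous_const)
    · apply hcfd.mono
      intro x hx
      simp only [Function.mem_support] at hx ⊢
      contrapose! hx
      simp [hx]
  have hparts : ∀ i, ∫ x, L i x * fderiv ℝ g x (e i) = - ∫ x, g x := by
    intro i
    have hL : ∀ x, fderiv ℝ (fun y => L i y) x (e i) = 1 := by
      intro x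
      rw [(L i).hasFDerivAt.fderiv]
      simp [L, e]
    have h := integral_mul_fderiv_eq_neg_fderiv_mul_of_integrable (μ := volume)
      (f := fun x => L i x) (g := g) (v := e i) ?_ (hint i) ?_ ?_ ?_
    · rw [h]
      simp only [hL, one_mul]
    · simp only [hL, one_mul]
      exact hg.continuous.integrable_of_hasCompactSupport hc
    · apply Continuous.integrable_of_hasCompactSupport
      · exact (L i).continuous.mul hg.continuous
      · exact hc.mul_left
    · intro x _
      exact (L i).differentiableAt
    · intro x _
      exact hg.differentiable (by simp) x
  have hsum : (fun x => fderiv ℝ g x x) = fun x => ∑ i, L i x * fderiv ℝ g x (e i) := by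
    funext x
    have hx : x = ∑ i, L i x • e i := by
      ext j
      simp [L, e, Finset.sum_apply, Pi.single_apply]
    have h := congrArg (fderiv ℝ g x) hx
    rw [map_sum] at h
    simpa using h
  rw [hsum]
  refine ⟨integrable_finsetSum _ fun i _ => hint i, ?_⟩
  rw [integral_finsetSum _ fun i _ => hint i]
  simp [hparts]

theorem hardy_young {p c a b : ℝ} (hp : 2 ≤ p) (hc : 0 ≤ c) (ha : 0 ≤ a) (hb : 0 ≤ b) :
    c ^ (p - 1) * (p * (a ^ (p - 1) * b)) ≤ (p - 1) * (c ^ p * a ^ p) + b ^ p := by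
  have hp1 : 0 < p - 1 := by linarith
  have hp0 : 0 < p := by linarith
  have h := Real.young_inequality_of_nonneg (a := b) (b := (c * a) ^ (p - 1)) hb
    (by positivity) ((Real.holderConjugate_iff_eq_conjExponent (by linarith)).2 rfl : p.HolderConjugate (p / (p - 1)))
  have h2 : ((c * a) ^ (p - 1)) ^ (p / (p - 1)) = c ^ p * a ^ p := by
    rw [← Real.rpow_mul (by positivity), mul_div_cancel₀ _ hp1.ne', Real.mul_rpow hc ha]
  rw [h2, Real.mul_rpow hc ha] at h
  have h3 := mul_le_mul_of_nonneg_left h hp0.le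
  have h4 : p * (b ^ p / p + c ^ p * a ^ p / (p / (p - 1)))
      = (p - 1) * (c ^ p * a ^ p) + b ^ p := by
    field_simp
    ring
  rw [h4] at h3
  linarith

theorem hardy_pointwise {N : ℕ} {p : ℝ} (hp : 2 ≤ p) (θ : ℝ)
    (u : EuclideanSpace ℝ (Fin N) → ℂ) (hu : Differentiable ℝ u)
    (x : EuclideanSpace ℝ (Fin N)) (hx : x ≠ 0) :
    |fderiv ℝ (fun x => ‖u x‖ ^ p * ‖x‖ ^ (-(p * θ))) x x
        + p * θ * (‖u x‖ ^ p * ‖x‖ ^ (-(p * θ)))|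
      ≤ p * (‖u x‖ ^ (p - 1) * ‖fderiv ℝ u x (‖x‖⁻¹ • x)‖ * ‖x‖ ^ (1 - p * θ)) := by
  have hn : 0 < ‖x‖ := norm_pos_iff.2 hx
  have h1 : HasFDerivAt (fun x => ‖u x‖ ^ p)
      (((p * ‖u x‖ ^ (p - 2)) • innerSL ℝ (u x)).comp (fderiv ℝ u x)) x :=
    (hasFDerivAt_norm_rpow (u x) (by linarith : 1 < p)).comp x (hu x).hasFDerivAt
  have hd : DifferentiableAt ℝ (fun y : EuclideanSpace ℝ (Fin N) => ‖y‖) x :=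
    (contDiffAt_norm ℝ (n := 1) hx).differentiableAt (by simp)
  have h2 := hd.hasFDerivAt.rpow_const (p := -(p * θ)) (Or.inl hn.ne')
  have h3 := (h1.mul h2).fderiv
  have h4 : fderiv ℝ (fun y : EuclideanSpace ℝ (Fin N) => ‖y‖) x x = ‖x‖ := hd.fderiv_norm_self
  have hDu : fderiv ℝ u x x = ‖x‖ • fderiv ℝ u x (‖x‖⁻¹ • x) := by
    rw [map_smul, smul_smul, mul_inv_cancel₀ hn.ne', one_smul]
  set D := fderiv ℝ u x (‖x‖⁻¹ • x) with hD
  have h5 : ‖x‖ ^ (-(p * θ) - 1) * ‖x‖ = ‖x‖ ^ (-(p * θ)) := by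
    rw [← Real.rpow_add_one hn.ne']; ring_nf
  have h6 : ‖x‖ ^ (-(p * θ)) * ‖x‖ = ‖x‖ ^ (1 - p * θ) := by
    rw [← Real.rpow_add_one hn.ne']; ring_nf
  have h7 : ‖u x‖ ^ (p - 2) * ‖u x‖ = ‖u x‖ ^ (p - 1) := by
    rw [← Real.rpow_add_one' (norm_nonneg _) (by linarith)]; ring_nf
  have h8 : fderiv ℝ (fun x => ‖u x‖ ^ p * ‖x‖ ^ (-(p * θ))) x x
        + p * θ * (‖u x‖ ^ p * ‖x‖ ^ (-(p * θ)))
      = p * ‖u x‖ ^ (p - 2) * inner ℝ (u x) D * ‖x‖ ^ (1 - p * θ) := by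
    have h3' := congrArg (fun T => T x) h3
    simp only [add_apply, smul_apply,
      ContinuousLinearMap.comp_apply, innerSL_apply_apply, smul_eq_mul, h4, hDu,
      real_inner_smul_right] at h3'
    refine (congrArg (· + p * θ * (‖u x‖ ^ p * ‖x‖ ^ (-(p * θ)))) h3').trans ?_
    rw [← h6, ← h5]
    ring
  rw [h8, abs_mul, abs_mul, abs_of_nonneg (by positivity : 0 ≤ p * ‖u x‖ ^ (p - 2)),
    abs_of_nonneg (by positivity : 0 ≤ ‖x‖ ^ (1 - p * θ)), ← h7]
  have h9 := abs_real_inner_le_norm (u x) D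
  calc p * ‖u x‖ ^ (p - 2) * |inner ℝ (u x) D| * ‖x‖ ^ (1 - p * θ)
      ≤ p * ‖u x‖ ^ (p - 2) * (‖u x‖ * ‖D‖) * ‖x‖ ^ (1 - p * θ) := by gcongr
    _ = _ := by ring

theorem hardy_rearrange {p θ r s t c : ℝ} (hp : 2 ≤ p) (hr : 0 < r) (hs : 0 ≤ s)
    (ht : 0 ≤ t) (hc : 0 ≤ c) :
    c ^ (p - 1) * (p * (s ^ (p - 1) * t * r ^ (1 - p * θ)))
      ≤ (p - 1) * (c ^ p * (s ^ p * r ^ (-(p * θ)))) + t ^ p * r ^ (-(p * (θ - 1))) := by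
  have h := hardy_young (a := s * r ^ (-θ)) (b := t * r ^ (1 - θ)) hp hc
    (by positivity) (by positivity)
  rw [Real.mul_rpow hs (by positivity), Real.mul_rpow hs (by positivity),
    Real.mul_rpow ht (by positivity), ← Real.rpow_mul hr.le, ← Real.rpow_mul hr.le,
    ← Real.rpow_mul hr.le] at h
  have e1 : r ^ (1 - p * θ) = r ^ (-θ * (p - 1)) * r ^ (1 - θ) := by
    rw [← Real.rpow_add hr]; ring_nf
  have e2 : -θ * p = -(p * θ) := by ring
  have e3 : (1 - θ) * p = -(p * (θ - 1)) := by ring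
  rw [e2, e3] at h
  rw [e1]
  calc _ = c ^ (p - 1) * (p * (s ^ (p - 1) * r ^ (-θ * (p - 1)) * (t * r ^ (1 - θ)))) := by ring
    _ ≤ _ := h

/-- **Weighted radial Hardy inequality in `ℝ^N`**: for `Ω ⊆ ℝ^N \ {0}` open and
`u ∈ C^∞_c(Ω;ℂ)`,
`∫_Ω |∇u·(x/|x|)|^p |x|^{-p(θ-1)} ≥ |(N-pθ)/p|^p ∫_Ω |u|^p |x|^{-pθ}`. -/
theorem hardy_radial_euclidean
    {N : ℕ} (hN : 1 ≤ N)
    {p : ℝ} (hp : 2 ≤ p) (θ : ℝ)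
    {Ω : Set (EuclideanSpace ℝ (Fin N))} (hΩ : IsOpen Ω)
    (hΩ0 : Ω ⊆ {x : EuclideanSpace ℝ (Fin N) | x ≠ 0}) :
    ∀ u : EuclideanSpace ℝ (Fin N) → ℂ,
      ContDiff ℝ (⊤ : ℕ∞) u → HasCompactSupport u → tsupport u ⊆ Ω →
      |((N : ℝ) - p * θ) / p| ^ p * ∫ x in Ω, ‖u x‖ ^ p * ‖x‖ ^ (-(p * θ))
        ≤ ∫ x in Ω, ‖fderiv ℝ u x (‖x‖⁻¹ • x)‖ ^ p * ‖x‖ ^ (-(p * (θ - 1))) := by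
  intro u hu hcs hsub
  have hp0 : 0 < p := by linarith
  have hev : ∀ x, x ∉ tsupport u → u =ᶠ[nhds x] 0 := fun x hx =>
    notMem_tsupport_iff_eventuallyEq.1 hx
  have hux : ∀ x, x ∉ tsupport u → u x = 0 := fun x hx => image_eq_zero_of_notMem_tsupport hx
  have hfdx : ∀ x, x ∉ tsupport u → fderiv ℝ u x = 0 := fun x hx => by
    have := (hev x hx).fderiv_eq (𝕜 := ℝ)
    simpa using this
  have hne : ∀ x, x ∈ tsupport u → x ≠ 0 := fun x hx => hΩ0 (hsub hx)
  have hdiff : Differentiable ℝ u := hu.differentiable (by simp)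
  have hfdc : Continuous (fderiv ℝ u) := hu.continuous_fderiv (by simp)
  set g : EuclideanSpace ℝ (Fin N) → ℝ := fun x => ‖u x‖ ^ p * ‖x‖ ^ (-(p * θ)) with hg
  set B : EuclideanSpace ℝ (Fin N) → ℝ :=
    fun x => ‖fderiv ℝ u x (‖x‖⁻¹ • x)‖ ^ p * ‖x‖ ^ (-(p * (θ - 1))) with hB
  have hg0 : ∀ x, x ∉ tsupport u → g x = 0 := fun x hx => by
    simp [hg, hux x hx, hp0.ne']
  have hB0 : ∀ x, x ∉ tsupport u → B x = 0 := fun x hx => by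
    simp [hB, hfdx x hx, hp0.ne']
  have hopen : ∀ x, x ∉ tsupport u → ∀ᶠ y in nhds x, y ∉ tsupport u := fun x hx =>
    (isClosed_tsupport u).isOpen_compl.mem_nhds hx
  have hgc : HasCompactSupport g := HasCompactSupport.intro hcs hg0
  have hBc : HasCompactSupport B := HasCompactSupport.intro hcs hB0
  have hg1 : ContDiff ℝ 1 g := by
    rw [contDiff_iff_contDiffAt]
    intro x
    by_cases hx : x ∈ tsupport u
    · have h1 : ContDiff ℝ 1 (fun x => ‖u x‖ ^ p) :=
        (contDiff_norm_rpow (by linarith : 1 < p)).comp (hu.of_le (by exact_mod_cast le_top))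
      exact h1.contDiffAt.mul
        ((contDiffAt_norm ℝ (hne x hx)).rpow_const_of_ne (norm_pos_iff.2 (hne x hx)).ne')
    · have : g =ᶠ[nhds x] fun _ => 0 := (hopen x hx).mono fun y hy => hg0 y hy
      exact contDiffAt_const.congr_of_eventuallyEq this
  have hBcont : Continuous B := by
    rw [continuous_iff_continuousAt]
    intro x
    by_cases hx : x ∈ tsupport u
    · have hn : ‖x‖ ≠ 0 := (norm_pos_iff.2 (hne x hx)).ne'
      have h1 : ContinuousAt (fun y : EuclideanSpace ℝ (Fin N) => ‖y‖⁻¹ • y) x :=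
        (continuous_norm.continuousAt.inv₀ hn).smul continuousAt_id
      have h2 := (hfdc.continuousAt (x := x)).clm_apply h1
      exact (h2.norm.rpow_const (Or.inr hp0.le)).mul
        (continuous_norm.continuousAt.rpow_const (Or.inl hn))
    · have : B =ᶠ[nhds x] fun _ => 0 := (hopen x hx).mono fun y hy => hB0 y hy
      exact continuousAt_const.congr this.symm
  have hgi : Integrable g := hg1.continuous.integrable_of_hasCompactSupport hgc
  have hBi : Integrable B := hBcont.integrable_of_hasCompactSupport hBc
  obtain ⟨hEi, hE⟩ := hardy_euler g hg1 hgc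
  rw [setIntegral_eq_integral_of_forall_compl_eq_zero fun x hx => hg0 x fun h => hx (hsub h),
    setIntegral_eq_integral_of_forall_compl_eq_zero fun x hx => hB0 x fun h => hx (hsub h)]
  set c : ℝ := |((N : ℝ) - p * θ) / p| with hcdef
  have hc0 : 0 ≤ c := abs_nonneg _
  have hcp : |(N : ℝ) - p * θ| = c * p := by
    rw [hcdef, abs_div, abs_of_pos hp0, div_mul_cancel₀ _ hp0.ne']
  set F : EuclideanSpace ℝ (Fin N) → ℝ := fun x => fderiv ℝ g x x + p * θ * g x with hF
  have hFi : Integrable F := hEi.add (hgi.const_mul _)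
  have hFint : ∫ x, F x = -((N : ℝ) - p * θ) * ∫ x, g x := by
    rw [hF, integral_add hEi (hgi.const_mul _), integral_const_mul, hE]
    ring
  have hpt : ∀ x, c ^ (p - 1) * |F x| ≤ (p - 1) * (c ^ p * g x) + B x := by
    intro x
    by_cases hx : x ∈ tsupport u
    · have h1 := hardy_pointwise hp θ u hdiff x (hne x hx)
      have h2 := hardy_rearrange (θ := θ) hp (norm_pos_iff.2 (hne x hx)) (norm_nonneg (u x))
        (norm_nonneg (fderiv ℝ u x (‖x‖⁻¹ • x))) hc0
      exact (mul_le_mul_of_nonneg_left h1 (Real.rpow_nonneg hc0 _)).trans h2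
    · have : g =ᶠ[nhds x] fun _ => 0 := (hopen x hx).mono fun y hy => hg0 y hy
      have h1 : fderiv ℝ g x = 0 := by
        rw [this.fderiv_eq]; simp
      simp [hF, h1, hg0 x hx, hB0 x hx]
  have hgnn : 0 ≤ ∫ x, g x := integral_nonneg fun x => by positivity
  have hI : c ^ (p - 1) * ∫ x, |F x| ≤ (p - 1) * (c ^ p * ∫ x, g x) + ∫ x, B x := by
    have := integral_mono (hFi.abs.const_mul (c ^ (p - 1)))
      (((hgi.const_mul (c ^ p)).const_mul (p - 1)).add hBi) hpt
    simp only [Pi.add_apply] at this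
    rwa [integral_add ((hgi.const_mul (c ^ p)).const_mul (p - 1)) hBi, integral_const_mul,
      integral_const_mul, integral_const_mul] at this
  have hJ : c * p * ∫ x, g x ≤ ∫ x, |F x| := by
    have h := abs_integral_le_integral_abs (f := F) (μ := volume)
    rwa [hFint, abs_mul, abs_neg, hcp, abs_of_nonneg hgnn] at h
  have hK := mul_le_mul_of_nonneg_left hJ (Real.rpow_nonneg hc0 (p - 1))
  have hcc : c ^ (p - 1) * c = c ^ p := by
    rw [← Real.rpow_add_one' hc0 (by linarith)]; ring_nf
  have hK' : c ^ (p - 1) * (c * p * ∫ x, g x) = p * (c ^ p * ∫ x, g x) := by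
    rw [← hcc]; ring
  linarith
end
end

section
/- Let N ≥ 1, let p ≥ 2 be a real number, let θ ∈ ℝ, and let Ω ⊆ ℝ^N \ {0} be an open set such that {x ∈ ℝ^N : 0 < |x| ≤ r} ⊆ Ω for some r > 0. Then the constant |(N − pθ)/p|^p is sharp in the weighted Hardy inequality: for every c > |(N − pθ)/p|^p there exists u ∈ C^∞_c(Ω;ℂ) with ∫_Ω |u(x)|^p |x|^{−pθ} dx > 0 and ∫_Ω |∇u(x)·(x/|x|)|^p |x|^{−p(θ−1)} dx < c ∫_Ω |u(x)|^p |x|^{−pθ} dx. -/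
open MeasureTheory Real

noncomputable section

lemma hrs_subst (ε L : ℝ) (hε : 0 < ε) (H : ℝ → ℝ) :
    ∫ y in Set.Ioi (0:ℝ), y⁻¹ * H (ε * (log y - L)) = ε⁻¹ * ∫ s, H s := by
  have hder : ∀ s ∈ (Set.univ : Set ℝ),
      HasDerivWithinAt (fun s : ℝ => exp (L + s / ε)) (exp (L + s / ε) * (1 / ε)) Set.univ s := by
    intro s _
    exact ((((hasDerivAt_id s).div_const ε).const_add L).exp).hasDerivWithinAt
  have hinj : Set.InjOn (fun s : ℝ => exp (L + s / ε)) Set.univ := by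
    intro a _ b _ hab
    have h := exp_injective hab
    have h2 : a / ε = b / ε := by linarith
    field_simp at h2
    exact h2
  have himg : (fun s : ℝ => exp (L + s / ε)) '' Set.univ = Set.Ioi 0 := by
    ext y
    constructor
    · rintro ⟨s, _, rfl⟩
      exact exp_pos _
    · intro hy
      refine ⟨ε * (log y - L), trivial, ?_⟩
      have : L + ε * (log y - L) / ε = log y := by field_simp; ring
      simp only [this]
      exact exp_log hy
  have h := integral_image_eq_integral_abs_deriv_smul MeasurableSet.univ hder hinj
    (fun y => y⁻¹ * H (ε * (log y - L)))
  rw [himg] at h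
  rw [h, setIntegral_univ, ← integral_const_mul]
  congr 1
  ext s
  have e1 : ε * (log (exp (L + s / ε)) - L) = s := by
    rw [log_exp]; field_simp; ring
  rw [e1, abs_of_pos (by positivity), smul_eq_mul]
  have := exp_pos (L + s / ε)
  field_simp

lemma hrs_polar {N : ℕ} (hN : 1 ≤ N) (ε L : ℝ) (hε : 0 < ε) (H F : ℝ → ℝ)
    (hFH : ∀ y : ℝ, 0 < y → y ^ (N - 1) * F y = y⁻¹ * H (ε * (log y - L))) :
    ∫ x : EuclideanSpace ℝ (Fin N), F ‖x‖ =
      (N * (volume : Measure (EuclideanSpace ℝ (Fin N))).real (Metric.ball 0 1) * ε⁻¹)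
        * ∫ s, H s := by
  have : Nonempty (Fin N) := ⟨⟨0, hN⟩⟩
  rw [integral_fun_norm_addHaar volume F]
  have : ∫ y in Set.Ioi (0:ℝ), y ^ (Module.finrank ℝ (EuclideanSpace ℝ (Fin N)) - 1) • F y
      = ε⁻¹ * ∫ s, H s := by
    rw [← hrs_subst ε L hε H]
    refine setIntegral_congr_fun measurableSet_Ioi ?_
    intro y hy
    simp only [finrank_euclideanSpace, Fintype.card_fin, smul_eq_mul]
    exact hFH y hy
  rw [this]
  simp only [finrank_euclideanSpace, Fintype.card_fin, smul_eq_mul, nsmul_eq_mul]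
  ring

lemma hrs_bump : ∃ φ : ℝ → ℝ, ContDiff ℝ (⊤ : ℕ∞) φ ∧ (∀ s, s ∉ Set.Ioo (-3:ℝ) (-1) → φ s = 0) ∧
    φ (-2) = 1 := by
  let b : ContDiffBump (-2 : ℝ) := ⟨1/2, 1, by norm_num, by norm_num⟩
  refine ⟨b, b.contDiff, ?_, ?_⟩
  · intro s hs
    have h : s ∉ Function.support b := by
      rw [b.support_eq, Real.ball_eq_Ioo]
      norm_num at hs ⊢
      exact hs
    simpa using h
  · exact b.one_of_mem_closedBall (by simp [b])

lemma hrs_pos (φ : ℝ → ℝ) (hc : Continuous φ) (h0 : ∀ s, s ∉ Set.Ioo (-3:ℝ) (-1) → φ s = 0)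
    (h1 : φ (-2) = 1) (p : ℝ) (hp : 0 < p) : 0 < ∫ s, |φ s| ^ p := by
  have hcont : Continuous (fun s => |φ s| ^ p) :=
    hc.abs.rpow_const (fun _ => Or.inr hp.le)
  refine hcont.integral_pos_of_hasCompactSupport_nonneg_nonzero ?_ (fun s => by positivity)
    (x := -2) (by simp [h1])
  refine HasCompactSupport.intro (isCompact_Icc (a := (-3:ℝ)) (b := -1)) ?_
  intro s hs
  rw [h0 s (fun h => hs (Set.Ioo_subset_Icc_self h))]
  simp [hp.ne']

lemma hrs_deriv_zero (φ : ℝ → ℝ) (hφ : ContDiff ℝ (⊤ : ℕ∞) φ)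
    (h0 : ∀ s, s ∉ Set.Ioo (-3:ℝ) (-1) → φ s = 0) (s : ℝ) (hs : s ∉ Set.Ioo (-3:ℝ) (-1)) :
    deriv φ s = 0 := by
  have hd : Differentiable ℝ φ := hφ.differentiable (by simp)
  have hc : Continuous (deriv φ) := hφ.continuous_deriv (by simp)
  have hcl : IsClosed {s | deriv φ s = 0} := isClosed_eq hc continuous_const
  have hz : ∀ t, t ∈ Set.Iio (-3:ℝ) ∪ Set.Ioi (-1) → deriv φ t = 0 := by
    intro t ht
    have : φ =ᶠ[nhds t] fun _ => 0 := by
      filter_upwards [(isOpen_Iio.union isOpen_Ioi).mem_nhds ht] with z hz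
      apply h0
      rintro ⟨h1, h2⟩
      rcases hz with hz | hz
      · exact absurd hz (not_lt.2 h1.le)
      · exact absurd hz (not_lt.2 h2.le)
    rw [this.deriv_eq]; simp
  have hsub : closure (Set.Iio (-3:ℝ) ∪ Set.Ioi (-1)) ⊆ {s | deriv φ s = 0} :=
    closure_minimal hz hcl
  apply hsub
  rw [closure_union, closure_Iio, closure_Ioi]
  by_contra hcon
  apply hs
  simp only [Set.mem_union, Set.mem_Iic, Set.mem_Ici, not_or, not_le] at hcon
  exact hcon

lemma hrs_eps (φ : ℝ → ℝ) (hφ : ContDiff ℝ (⊤ : ℕ∞) φ)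
    (h0 : ∀ s, s ∉ Set.Ioo (-3:ℝ) (-1) → φ s = 0) (h1 : φ (-2) = 1)
    (p a c : ℝ) (hp : 0 < p) (hc : |a| ^ p < c) :
    ∃ ε > 0, ∫ s, |-a * φ s + ε * deriv φ s| ^ p < c * ∫ s, |φ s| ^ p := by
  have hdc : Continuous (deriv φ) := hφ.continuous_deriv (by simp)
  have hJ : ∀ ε : ℝ, ∫ s, |-a * φ s + ε * deriv φ s| ^ p
      = ∫ s in Set.Icc (-3:ℝ) (-1), |-a * φ s + ε * deriv φ s| ^ p := by
    intro ε
    rw [setIntegral_eq_integral_of_forall_compl_eq_zero]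
    intro s hs
    have hs' : s ∉ Set.Ioo (-3:ℝ) (-1) := fun h => hs (Set.Ioo_subset_Icc_self h)
    rw [h0 s hs', hrs_deriv_zero φ hφ h0 s hs']
    simp [hp.ne']
  have hcont : Continuous (fun ε : ℝ =>
      ∫ s in Set.Icc (-3:ℝ) (-1), |-a * φ s + ε * deriv φ s| ^ p) := by
    apply continuous_parametric_integral_of_continuous _ isCompact_Icc
    apply Continuous.rpow_const
    · have := hφ.continuous
      fun_prop
    · intro _; exact Or.inr hp.le
  have hI := hrs_pos φ hφ.continuous h0 h1 p hp
  have hat0 : (∫ s in Set.Icc (-3:ℝ) (-1), |-a * φ s + 0 * deriv φ s| ^ p)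
      < c * ∫ s, |φ s| ^ p := by
    rw [← hJ]
    have : ∀ s, |-a * φ s + 0 * deriv φ s| ^ p = |a| ^ p * |φ s| ^ p := by
      intro s
      rw [zero_mul, add_zero, abs_mul, abs_neg, mul_rpow (abs_nonneg _) (abs_nonneg _)]
    simp_rw [this]
    rw [integral_const_mul]
    exact mul_lt_mul_of_pos_right hc hI
  have hev := (hcont.tendsto 0).eventually_lt_const hat0
  have hev2 := (hev.filter_mono (nhdsWithin_le_nhds (s := Set.Ioi 0))).and self_mem_nhdsWithin
  obtain ⟨ε, h2, h3⟩ := hev2.exists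
  exact ⟨ε, h3, by rw [hJ]; exact h2⟩

lemma hrs_main
    {N : ℕ} (hN : 1 ≤ N)
    {p : ℝ} (hp : 2 ≤ p) (θ : ℝ)
    {Ω : Set (EuclideanSpace ℝ (Fin N))}
    {r : ℝ} (hr : 0 < r)
    (hball : {x : EuclideanSpace ℝ (Fin N) | 0 < ‖x‖ ∧ ‖x‖ ≤ r} ⊆ Ω) (c : ℝ)
    (hc : |((N : ℝ) - p * θ) / p| ^ p < c) :
      ∃ u : EuclideanSpace ℝ (Fin N) → ℂ,
        ContDiff ℝ (⊤ : ℕ∞) u ∧ HasCompactSupport u ∧ tsupport u ⊆ Ω ∧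
        0 < ∫ x in Ω, ‖u x‖ ^ p * ‖x‖ ^ (-(p * θ)) ∧
        ∫ x in Ω, ‖fderiv ℝ u x (‖x‖⁻¹ • x)‖ ^ p * ‖x‖ ^ (-(p * (θ - 1)))
          < c * ∫ x in Ω, ‖u x‖ ^ p * ‖x‖ ^ (-(p * θ)) := by
  have hp0 : 0 < p := by linarith
  obtain ⟨φ, hφ, h0, h1⟩ := hrs_bump
  set a : ℝ := ((N : ℝ) - p * θ) / p with ha
  have hap : a * p = N - p * θ := by rw [ha]; field_simp
  obtain ⟨ε, hε, hlt⟩ := hrs_eps φ hφ h0 h1 p a c hp0 hc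
  set L : ℝ := min (log r) 0 with hL
  have hL0 : L ≤ 0 := min_le_right _ _
  have hLr : L ≤ log r := min_le_left _ _
  set ψ : ℝ → ℝ := fun y => exp (-a * log y) * φ (ε * (log y - L)) with hψ
  have hnot0 : ε * (log 0 - L) ∉ Set.Ioo (-3:ℝ) (-1) := by
    rintro ⟨_, h⟩
    have : 0 ≤ ε * (log 0 - L) := mul_nonneg hε.le (by rw [log_zero]; linarith)
    linarith
  have hψ0 : ψ 0 = 0 := by simp only [hψ]; rw [h0 _ hnot0, mul_zero]
  -- support bounds
  have hsupp : ∀ y, 0 ≤ y → ψ y ≠ 0 → exp (L - 3 / ε) ≤ y ∧ y ≤ exp (L - 1 / ε) := by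
    intro y hy hne
    have hy0 : 0 < y := lt_of_le_of_ne hy (fun h => hne (h ▸ hψ0))
    have hm : ε * (log y - L) ∈ Set.Ioo (-3:ℝ) (-1) := by
      by_contra h
      exact hne (by simp only [hψ]; rw [h0 _ h, mul_zero])
    rw [← le_log_iff_exp_le hy0, ← log_le_iff_le_exp hy0]
    have e3 : ε * (3 / ε) = 3 := by field_simp
    have e1 : ε * (1 / ε) = 1 := by field_simp
    constructor
    · refine le_of_mul_le_mul_left ?_ hε
      nlinarith [hm.1]
    · refine le_of_mul_le_mul_left ?_ hε
      nlinarith [hm.2]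
  have hψs : ∀ y, 0 < y → ContDiffAt ℝ (⊤ : ℕ∞) ψ y := by
    intro y hy
    have hlog : ContDiffAt ℝ (⊤ : ℕ∞) log y := contDiffAt_log.2 hy.ne'
    have hA : ContDiffAt ℝ (⊤ : ℕ∞) (fun y => exp (-a * log y)) y :=
      (contDiffAt_const.mul hlog).exp
    have hB : ContDiffAt ℝ (⊤ : ℕ∞) (fun y => φ (ε * (log y - L))) y :=
      hφ.contDiffAt.comp y (contDiffAt_const.mul (hlog.sub contDiffAt_const))
    exact hA.mul hB
  have hψd : ∀ y, 0 < y → HasDerivAt ψ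
      (y⁻¹ * exp (-a * log y) * (-a * φ (ε * (log y - L)) + ε * deriv φ (ε * (log y - L)))) y := by
    intro y hy
    have hlog := hasDerivAt_log hy.ne'
    have hA := (hlog.const_mul (-a)).exp
    have hφd : HasDerivAt φ (deriv φ (ε * (log y - L))) (ε * (log y - L)) :=
      (hφ.differentiable (by simp) _).hasDerivAt
    have hB : HasDerivAt (fun y => φ (ε * (log y - L))) _ y :=
      hφd.comp y ((hlog.sub_const L).const_mul ε)
    refine (hA.mul hB).congr_deriv ?_
    ring
  set u : EuclideanSpace ℝ (Fin N) → ℂ := fun x => ((ψ ‖x‖ : ℝ) : ℂ) with hu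
  set K : Set (EuclideanSpace ℝ (Fin N)) :=
    {x | exp (L - 3 / ε) ≤ ‖x‖ ∧ ‖x‖ ≤ exp (L - 1 / ε)} with hK
  have hKcl : IsClosed K :=
    (isClosed_le continuous_const continuous_norm).inter
      (isClosed_le continuous_norm continuous_const)
  have huK : ∀ x, x ∉ K → u x = 0 := by
    intro x hx
    by_contra hne
    apply hx
    refine hsupp ‖x‖ (norm_nonneg x) ?_
    intro h
    exact hne (by simp [hu, h])
  have hKcomp : IsCompact K := by
    refine (isCompact_closedBall (0 : EuclideanSpace ℝ (Fin N)) (exp (L - 1 / ε))).of_isClosed_subset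
      hKcl ?_
    intro x hx
    simpa using hx.2
  have htK : tsupport u ⊆ K := by
    refine closure_minimal ?_ hKcl
    intro x hx
    by_contra h
    exact hx (huK x h)
  have hKΩ : K ⊆ Ω := by
    intro x hx
    apply hball
    refine ⟨lt_of_lt_of_le (exp_pos _) hx.1, hx.2.trans ?_⟩
    rw [← le_log_iff_exp_le hr]
    have : 0 < 1 / ε := by positivity
    linarith
  have hus : ContDiff ℝ (⊤ : ℕ∞) u := by
    rw [contDiff_iff_contDiffAt]
    intro x
    by_cases hx : x = 0
    · have : u =ᶠ[nhds x] fun _ => 0 := by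
        have : Kᶜ ∈ nhds x := by
          refine hKcl.isOpen_compl.mem_nhds ?_
          intro h
          have h1 := h.1
          rw [hx, norm_zero] at h1
          exact absurd h1 (not_le.2 (exp_pos _))
        filter_upwards [this] with z hz
        exact huK z hz
      exact contDiffAt_const.congr_of_eventuallyEq this
    · have h2 : ContDiffAt ℝ (⊤ : ℕ∞) (fun x : EuclideanSpace ℝ (Fin N) => ψ ‖x‖) x :=
        (hψs ‖x‖ (norm_pos_iff.2 hx)).comp x (contDiffAt_norm ℝ hx)
      exact Complex.ofRealCLM.contDiff.contDiffAt.comp x h2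
  have hcs : HasCompactSupport u := HasCompactSupport.intro hKcomp huK
  have htΩ : tsupport u ⊆ Ω := htK.trans hKΩ
  have hfd : ∀ x, fderiv ℝ u x (‖x‖⁻¹ • x) = ((‖x‖⁻¹ * exp (-a * log ‖x‖) *
      (-a * φ (ε * (log ‖x‖ - L)) + ε * deriv φ (ε * (log ‖x‖ - L))) : ℝ) : ℂ) := by
    intro x
    by_cases hx : x = 0
    · simp [hx]
    · have hx0 : 0 < ‖x‖ := norm_pos_iff.2 hx
      set v := ‖x‖⁻¹ • x with hv
      have hv1 : ‖v‖ = 1 := by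
        rw [hv, norm_smul, norm_inv, norm_norm, inv_mul_cancel₀ hx0.ne']
      have hxv : ‖x‖ • v = x := by rw [hv, smul_smul, mul_inv_cancel₀ hx0.ne', one_smul]
      have hud : HasFDerivAt u (fderiv ℝ u x) (‖x‖ • v) := by
        rw [hxv]
        exact (hus.differentiable (by simp) x).hasFDerivAt
      have hl : HasDerivAt (fun t : ℝ => t • v) v ‖x‖ := by
        simpa using (hasDerivAt_id ‖x‖).smul_const v
      have hd1 : HasDerivAt (fun t : ℝ => u (t • v)) (fderiv ℝ u x v) ‖x‖ :=
        hud.comp_hasDerivAt ‖x‖ hl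
      have hd2 := (hψd ‖x‖ hx0).ofReal_comp
      have heq : (fun t : ℝ => u (t • v)) =ᶠ[nhds ‖x‖] fun t => ((ψ t : ℝ) : ℂ) := by
        filter_upwards [isOpen_Ioi.mem_nhds (show ‖x‖ ∈ Set.Ioi 0 from hx0)] with t ht
        simp only [hu]
        rw [norm_smul, hv1, mul_one, Real.norm_of_nonneg (le_of_lt ht)]
      exact (hd1.congr_of_eventuallyEq heq.symm).unique hd2
  set C : ℝ := N * (volume : Measure (EuclideanSpace ℝ (Fin N))).real (Metric.ball 0 1) * ε⁻¹
    with hC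
  have hCpos : 0 < C := by
    have hb : 0 < (volume : Measure (EuclideanSpace ℝ (Fin N))).real (Metric.ball 0 1) :=
      ENNReal.toReal_pos (Metric.measure_ball_pos volume _ one_pos).ne' measure_ball_lt_top.ne
    have hN0 : (0:ℝ) < N := by exact_mod_cast hN
    positivity
  -- power bookkeeping
  have hpow : ∀ y : ℝ, 0 < y →
      y ^ (N - 1) * ((exp (-a * log y)) ^ p * y ^ (-(p * θ))) = y⁻¹ := by
    intro y hy
    have e1 : y ^ (N - 1) = exp (log y * (N - 1)) := by
      rw [← Real.rpow_natCast, Nat.cast_sub hN, Nat.cast_one, rpow_def_of_pos hy]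
    rw [e1, rpow_def_of_pos hy, ← exp_mul, ← exp_add, ← exp_add]
    have : log y * (N - 1) + (-a * log y * p + log y * (-(p * θ))) = - log y := by
      linear_combination (-log y) * hap
    rw [this, exp_neg, exp_log hy]
  have hint1 : ∫ x in Ω, ‖u x‖ ^ p * ‖x‖ ^ (-(p * θ)) = C * ∫ s, |φ s| ^ p := by
    rw [setIntegral_eq_integral_of_forall_compl_eq_zero]
    · have := hrs_polar hN ε L hε (fun s => |φ s| ^ p)
        (fun y => |ψ y| ^ p * y ^ (-(p * θ))) ?_
      · rw [← hC] at this
        rw [← this]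
        congr 1
        ext x
        simp only [hu, Complex.norm_real, Real.norm_eq_abs]
      · intro y hy
        simp only [hψ]
        rw [abs_mul, abs_of_pos (exp_pos _), mul_rpow (exp_pos _).le (abs_nonneg _)]
        rw [← hpow y hy]
        ring
    · intro x hx
      rw [huK x (fun h => hx (hKΩ h))]
      simp [hp0.ne']
  have hint2 : ∫ x in Ω, ‖fderiv ℝ u x (‖x‖⁻¹ • x)‖ ^ p * ‖x‖ ^ (-(p * (θ - 1)))
      = C * ∫ s, |-a * φ s + ε * deriv φ s| ^ p := by
    rw [setIntegral_eq_integral_of_forall_compl_eq_zero]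
    · have := hrs_polar hN ε L hε (fun s => |-a * φ s + ε * deriv φ s| ^ p)
        (fun y => |y⁻¹ * exp (-a * log y) *
      (-a * φ (ε * (log y - L)) + ε * deriv φ (ε * (log y - L)))| ^ p
          * y ^ (-(p * (θ - 1)))) ?_
      · rw [← hC] at this
        rw [← this]
        congr 1
        ext x
        rw [hfd]
        simp only [Complex.norm_real, Real.norm_eq_abs]
      · intro y hy
        have hyi : 0 < y⁻¹ := inv_pos.2 hy
        rw [abs_mul, abs_mul, abs_of_pos (exp_pos _), abs_of_pos hyi,
          mul_rpow (by positivity) (abs_nonneg _), mul_rpow hyi.le (exp_pos _).le]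
        have e : y ^ (-(p * (θ - 1))) = y ^ p * y ^ (-(p * θ)) := by
          rw [← rpow_add hy]; congr 1; ring
        have e2 : y⁻¹ ^ p * y ^ p = 1 := by
          rw [← mul_rpow hyi.le hy.le, inv_mul_cancel₀ hy.ne', one_rpow]
        have hpw := hpow y hy
        rw [e]
        generalize |-a * φ (ε * (log y - L)) + ε * deriv φ (ε * (log y - L))| ^ p = Z
        generalize exp (-a * log y) ^ p = W at hpw ⊢
        linear_combination (y ^ (N - 1) * W * Z * y ^ (-(p * θ))) * e2 + Z * hpw
    · intro x hx
      have : fderiv ℝ u x = 0 := by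
        have h := tsupport_fderiv_subset (𝕜 := ℝ) (f := u)
        by_contra hne
        exact hx (htΩ (h (subset_tsupport _ hne)))
      rw [this]
      simp [hp0.ne']
  refine ⟨u, hus, hcs, htΩ, ?_, ?_⟩
  · rw [hint1]
    exact mul_pos hCpos (hrs_pos φ hφ.continuous h0 h1 p hp0)
  · rw [hint1, hint2]
    have := mul_lt_mul_of_pos_left hlt hCpos
    linarith

/-- **Sharpness of the constant in the weighted radial Hardy inequality**: if `Ω ∪ {0}`
contains a neighbourhood of the origin (i.e. `{0 < |x| ≤ r} ⊆ Ω` for some `r > 0`),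
then for any `c` larger than `|(N-pθ)/p|^p` there is `u ∈ C^∞_c(Ω;ℂ)` violating the
inequality with constant `c`. -/
theorem hardy_radial_euclidean_sharp
    {N : ℕ} (hN : 1 ≤ N)
    {p : ℝ} (hp : 2 ≤ p) (θ : ℝ)
    {Ω : Set (EuclideanSpace ℝ (Fin N))} (hΩ : IsOpen Ω)
    (hΩ0 : Ω ⊆ {x : EuclideanSpace ℝ (Fin N) | x ≠ 0})
    {r : ℝ} (hr : 0 < r)
    (hball : {x : EuclideanSpace ℝ (Fin N) | 0 < ‖x‖ ∧ ‖x‖ ≤ r} ⊆ Ω) :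
    ∀ c : ℝ, |((N : ℝ) - p * θ) / p| ^ p < c →
      ∃ u : EuclideanSpace ℝ (Fin N) → ℂ,
        ContDiff ℝ (⊤ : ℕ∞) u ∧ HasCompactSupport u ∧ tsupport u ⊆ Ω ∧
        0 < ∫ x in Ω, ‖u x‖ ^ p * ‖x‖ ^ (-(p * θ)) ∧
        ∫ x in Ω, ‖fderiv ℝ u x (‖x‖⁻¹ • x)‖ ^ p * ‖x‖ ^ (-(p * (θ - 1)))
          < c * ∫ x in Ω, ‖u x‖ ^ p * ‖x‖ ^ (-(p * θ)) := by
  intro c hc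
  exact hrs_main hN hp θ hr hball c hc
end
end

section
/- Let N ≥ 1, let p ≥ 2 be a real number, let θ ∈ ℝ, let R > 0, and let Ω ⊆ {x ∈ ℝ^N : 0 < |x| < R} be an open set. Then for every u ∈ C^∞_c(Ω;ℂ): ∫_Ω |∇u(x)·(x/|x|)|^p (log(R/|x|))^{θ+p} |x|^{−(N−p)} dx ≥ |(θ+1)/p|^p ∫_Ω |u(x)|^p |x|^{−N} (log(R/|x|))^{θ} dx. -/
open MeasureTheory Real

noncomputable section

lemma hle_euler {N : ℕ} (h : EuclideanSpace ℝ (Fin N) → ℝ) (hc : ContDiff ℝ 1 h)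
    (hs : HasCompactSupport h) :
    ∫ x, fderiv ℝ h x x = -((N : ℝ) * ∫ x, h x) := by
  have hd : Differentiable ℝ h := hc.differentiable one_ne_zero
  have hcf : Continuous (fderiv ℝ h) := hc.continuous_fderiv one_ne_zero
  have hsf : HasCompactSupport (fderiv ℝ h) := hs.fderiv ℝ
  have hi : ∀ v : EuclideanSpace ℝ (Fin N), HasCompactSupport (fun x => fderiv ℝ h x v) :=
    fun v => hs.fderiv_apply ℝ v
  have hci : ∀ v : EuclideanSpace ℝ (Fin N), Continuous (fun x => fderiv ℝ h x v) :=
    fun v => hcf.clm_apply continuous_const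
  have hint : ∀ i : Fin N, Integrable (fun x : EuclideanSpace ℝ (Fin N) =>
      x i * fderiv ℝ h x (EuclideanSpace.single i 1)) := by
    intro i
    refine Continuous.integrable_of_hasCompactSupport ?_ ?_
    · exact (EuclideanSpace.proj i : EuclideanSpace ℝ (Fin N) →L[ℝ] ℝ).continuous.mul (hci _)
    · exact (hi _).mul_left
  have hexp : ∀ x : EuclideanSpace ℝ (Fin N),
      fderiv ℝ h x x = ∑ i, x i * fderiv ℝ h x (EuclideanSpace.single i 1) := by
    intro x
    have hx : x = ∑ i, x i • EuclideanSpace.single i (1:ℝ) := by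
      have := (EuclideanSpace.basisFun (Fin N) ℝ).sum_repr x
      simpa using this.symm
    conv_lhs => arg 2; rw [hx]
    rw [map_sum]
    simp
  simp_rw [hexp]
  rw [integral_finsetSum _ (fun i _ => hint i)]
  have hone : ∀ i : Fin N, ∫ x : EuclideanSpace ℝ (Fin N),
      x i * fderiv ℝ h x (EuclideanSpace.single i 1) = - ∫ x, h x := by
    intro i
    set L : EuclideanSpace ℝ (Fin N) →L[ℝ] ℝ := EuclideanSpace.proj i with hL
    have hfL : ∀ x, fderiv ℝ L x (EuclideanSpace.single i 1) = 1 := by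
      intro x
      rw [L.fderiv]
      simp [hL]
    have := integral_mul_fderiv_eq_neg_fderiv_mul_of_integrable (μ := volume)
      (f := L) (g := h) (v := EuclideanSpace.single i 1) ?_ (hint i) ?_ ?_ ?_
    · simp_rw [hfL, one_mul] at this
      exact this
    · simp_rw [hfL, one_mul]
      exact hc.continuous.integrable_of_hasCompactSupport hs
    · exact (L.continuous.mul hc.continuous).integrable_of_hasCompactSupport hs.mul_left
    · exact fun x _ => L.differentiableAt
    · exact fun x _ => hd x
  simp_rw [hone]
  simp

lemma hle_radial {N : ℕ} {R : ℝ} (θ : ℝ) (f : EuclideanSpace ℝ (Fin N) → ℝ)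
    (x : EuclideanSpace ℝ (Fin N)) (hx : 0 < ‖x‖) (hxR : ‖x‖ < R)
    (hf : DifferentiableAt ℝ f x)
    (hh : DifferentiableAt ℝ
      (fun x => f x * (‖x‖ ^ (-(N : ℝ)) * Real.log (R / ‖x‖) ^ (θ + 1))) x) :
    fderiv ℝ (fun x => f x * (‖x‖ ^ (-(N : ℝ)) * Real.log (R / ‖x‖) ^ (θ + 1))) x x
      = fderiv ℝ f x x * (‖x‖ ^ (-(N : ℝ)) * Real.log (R / ‖x‖) ^ (θ + 1))
        - N * (f x * (‖x‖ ^ (-(N : ℝ)) * Real.log (R / ‖x‖) ^ (θ + 1)))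
        - (θ + 1) * (f x * ‖x‖ ^ (-(N : ℝ)) * Real.log (R / ‖x‖) ^ θ) := by
  have hl : HasDerivAt (fun t : ℝ => t • x) x 1 := by
    simpa using (hasDerivAt_id (1:ℝ)).smul_const x
  have hr : HasDerivAt (fun t : ℝ => ‖t • x‖) ‖x‖ 1 := by
    have h1 : HasDerivAt (fun t : ℝ => t * ‖x‖) ‖x‖ 1 := by
      simpa using (hasDerivAt_id (1:ℝ)).mul_const ‖x‖
    refine h1.congr_of_eventuallyEq ?_
    filter_upwards [lt_mem_nhds (zero_lt_one : (0:ℝ) < 1)] with t ht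
    rw [norm_smul, Real.norm_of_nonneg ht.le]
  have hone : (1:ℝ) • x = x := one_smul _ x
  have e1 := (show HasFDerivAt _ _ ((1:ℝ) • x) by rw [hone]; exact hh.hasFDerivAt).comp_hasDerivAt
    (1:ℝ) hl
  have e2 := (show HasFDerivAt f (fderiv ℝ f x) ((1:ℝ) • x) by
    rw [hone]; exact hf.hasFDerivAt).comp_hasDerivAt (1:ℝ) hl
  have hR : 0 < R := hx.trans hxR
  have hlog : 0 < Real.log (R / ‖x‖) := Real.log_pos ((one_lt_div hx).2 hxR)
  have e3 : HasDerivAt (fun t : ℝ => ‖t • x‖ ^ (-(N : ℝ)))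
      (‖x‖ * (-(N:ℝ)) * ‖x‖ ^ (-(N : ℝ) - 1)) 1 := by
    have := hr.rpow_const (p := -(N : ℝ)) (Or.inl (by rw [hone]; exact hx.ne'))
    simpa only [hone] using this
  have e4 : HasDerivAt (fun t : ℝ => Real.log (R / ‖t • x‖)) (-1) 1 := by
    have := ((hasDerivAt_const (1:ℝ) R).div hr (by rw [hone]; exact hx.ne')).log
      (by simp only [Pi.div_apply, hone]; positivity)
    convert this using 1
    simp only [Pi.div_apply]
    rw [hone]
    have hx' := hx.ne'
    have hR' := hR.ne'
    field_simp
    simp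
    try field_simp
  have e5 := e4.rpow_const (p := θ + 1) (Or.inl (by rw [hone]; exact hlog.ne'))
  have e6 := e2.mul (e3.mul e5)
  have := e1.unique e6
  simp only [Function.comp_apply, hone, Pi.mul_apply] at this
  rw [this]
  rw [Real.rpow_sub_one hx.ne', add_sub_cancel_right]
  field_simp
  ring

lemma hle_continuous {N : ℕ} {Ω K : Set (EuclideanSpace ℝ (Fin N))} (hK : IsCompact K)
    (hKΩ : K ⊆ Ω) (g : EuclideanSpace ℝ (Fin N) → ℝ) (h0 : ∀ x ∉ K, g x = 0)
    (hg : ∀ x ∈ Ω, ContinuousAt g x) : Integrable g := by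
  refine Continuous.integrable_of_hasCompactSupport ?_ (HasCompactSupport.intro hK h0)
  rw [continuous_iff_continuousAt]
  intro x
  by_cases hx : x ∈ K
  · exact hg x (hKΩ hx)
  · have : g =ᶠ[nhds x] fun _ => 0 := by
      filter_upwards [hK.isClosed.isOpen_compl.mem_nhds hx] with y hy using h0 y hy
    exact continuousAt_const.congr this.symm

/-- pointwise Young inequality -/
lemma hle_young {p a s y : ℝ} (hp : 2 ≤ p) (ha : 0 < a) (hs : 0 ≤ s) (hy : 0 ≤ y) :
    p * a ^ (p - 1) * (s ^ (p - 1) * y) ≤ (p - 1) * (a ^ p * s ^ p) + y ^ p := by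
  have hp1 : 1 < p := by linarith
  have hpq : (p.conjExponent).HolderConjugate p := (Real.HolderConjugate.conjExponent hp1).symm
  have := Real.young_inequality_of_nonneg (a := (a * s) ^ (p - 1)) (b := y) (by positivity) hy hpq
  rw [← Real.rpow_mul (by positivity)] at this
  have hpp : (p - 1) * p.conjExponent = p := by
    unfold Real.conjExponent
    field_simp [show p - 1 ≠ 0 by linarith]
  rw [hpp, Real.mul_rpow ha.le hs, Real.mul_rpow ha.le hs] at this
  have h2 := mul_le_mul_of_nonneg_left this (show 0 ≤ p by linarith)
  have h3 : p * (a ^ p * s ^ p / p.conjExponent + y ^ p / p)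
      = (p - 1) * (a ^ p * s ^ p) + y ^ p := by
    unfold Real.conjExponent
    field_simp [show p - 1 ≠ 0 by linarith]
  rw [h3] at h2
  linarith

/-- **Logarithmic Hardy inequality in `ℝ^N`**: for `Ω ⊆ {0 < |x| < R}` open and
`u ∈ C^∞_c(Ω;ℂ)`,
`∫_Ω |∇u·(x/|x|)|^p (log(R/|x|))^{θ+p} |x|^{-(N-p)} ≥ |(θ+1)/p|^p ∫_Ω |u|^p |x|^{-N} (log(R/|x|))^θ`. -/
theorem hardy_logarithmic_euclidean
    {N : ℕ} (hN : 1 ≤ N)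
    {p : ℝ} (hp : 2 ≤ p) (θ : ℝ)
    {R : ℝ} (hR : 0 < R)
    {Ω : Set (EuclideanSpace ℝ (Fin N))} (hΩ : IsOpen Ω)
    (hΩ0 : Ω ⊆ {x : EuclideanSpace ℝ (Fin N) | 0 < ‖x‖ ∧ ‖x‖ < R}) :
    ∀ u : EuclideanSpace ℝ (Fin N) → ℂ,
      ContDiff ℝ (⊤ : ℕ∞) u → HasCompactSupport u → tsupport u ⊆ Ω →
      |(θ + 1) / p| ^ p *
          ∫ x in Ω, ‖u x‖ ^ p * ‖x‖ ^ (-(N : ℝ)) * Real.log (R / ‖x‖) ^ θ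
        ≤ ∫ x in Ω, ‖fderiv ℝ u x (‖x‖⁻¹ • x)‖ ^ p *
            Real.log (R / ‖x‖) ^ (θ + p) * ‖x‖ ^ (-((N : ℝ) - p)) := by
  intro u hu hcs hts
  have hp1 : 1 < p := by linarith
  have hp0 : 0 < p := by linarith
  have hu1 : ContDiff ℝ 1 u := hu.of_le (by exact_mod_cast le_top)
  have hud : Differentiable ℝ u := hu1.differentiable one_ne_zero
  have hfu : Continuous (fderiv ℝ u) := hu1.continuous_fderiv one_ne_zero
  have hu0 : ∀ x ∉ tsupport u, u x = 0 := fun x hx => image_eq_zero_of_notMem_tsupport hx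
  have hfu0 : ∀ x ∉ tsupport u, fderiv ℝ u x = 0 := fun x hx =>
    image_eq_zero_of_notMem_tsupport (fun h => hx (tsupport_fderiv_subset ℝ h))
  have hK : IsCompact (tsupport u) := hcs
  set a : ℝ := |(θ + 1) / p| with ha
  set f : EuclideanSpace ℝ (Fin N) → ℝ := fun x => ‖u x‖ ^ p with hf
  have hfc : ContDiff ℝ 1 f := hu1.norm_rpow hp1
  have hfd : Differentiable ℝ f := hfc.differentiable one_ne_zero
  have hff : Continuous (fderiv ℝ f) := hfc.continuous_fderiv one_ne_zero
  have hf0 : ∀ x ∉ tsupport u, f x = 0 := fun x hx => by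
    simp [hf, hu0 x hx, Real.zero_rpow hp0.ne']
  have hff' : ∀ x, fderiv ℝ f x = (p * ‖u x‖ ^ (p - 2)) • (innerSL ℝ (u x)).comp (fderiv ℝ u x) :=
    fun x => hud.fderiv_norm_rpow hp1
  have hff0 : ∀ x ∉ tsupport u, fderiv ℝ f x = 0 := fun x hx => by
    rw [hff' x, hfu0 x hx]; simp
  have hlog : ∀ x ∈ Ω, 0 < Real.log (R / ‖x‖) := fun x hx =>
    Real.log_pos ((one_lt_div (hΩ0 hx).1).2 (hΩ0 hx).2)
  -- smoothness of weights
  have hnC : ∀ x ∈ Ω, ContDiffAt ℝ 1 (fun x : EuclideanSpace ℝ (Fin N) => ‖x‖) x :=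
    fun x hx => contDiffAt_norm ℝ (norm_pos_iff.1 (hΩ0 hx).1)
  have hlC : ∀ x ∈ Ω,
      ContDiffAt ℝ 1 (fun x : EuclideanSpace ℝ (Fin N) => Real.log (R / ‖x‖)) x := by
    intro x hx
    have hx0 := (hΩ0 hx).1
    exact (contDiffAt_const.div (hnC x hx) hx0.ne').log (div_pos hR hx0).ne'
  have hnr : ∀ q : ℝ, ∀ x ∈ Ω,
      ContDiffAt ℝ 1 (fun x : EuclideanSpace ℝ (Fin N) => ‖x‖ ^ q) x :=
    fun q x hx => (hnC x hx).rpow_const_of_ne (hΩ0 hx).1.ne'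
  have hlr : ∀ q : ℝ, ∀ x ∈ Ω,
      ContDiffAt ℝ 1 (fun x : EuclideanSpace ℝ (Fin N) => Real.log (R / ‖x‖) ^ q) x :=
    fun q x hx => (hlC x hx).rpow_const_of_ne (hlog x hx).ne'
  set h : EuclideanSpace ℝ (Fin N) → ℝ :=
    fun x => f x * (‖x‖ ^ (-(N : ℝ)) * Real.log (R / ‖x‖) ^ (θ + 1)) with hh
  set A : EuclideanSpace ℝ (Fin N) → ℝ :=
    fun x => ‖u x‖ ^ p * ‖x‖ ^ (-(N : ℝ)) * Real.log (R / ‖x‖) ^ θ with hA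
  set B : EuclideanSpace ℝ (Fin N) → ℝ :=
    fun x => ‖fderiv ℝ u x (‖x‖⁻¹ • x)‖ ^ p *
            Real.log (R / ‖x‖) ^ (θ + p) * ‖x‖ ^ (-((N : ℝ) - p)) with hB
  set D : EuclideanSpace ℝ (Fin N) → ℝ :=
    fun x => fderiv ℝ f x x * (‖x‖ ^ (-(N : ℝ)) * Real.log (R / ‖x‖) ^ (θ + 1)) with hD
  have hh0 : ∀ x ∉ tsupport u, h x = 0 := fun x hx => by simp [hh, hf0 x hx]
  have hA0 : ∀ x ∉ tsupport u, A x = 0 := fun x hx => by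
    simp [hA, hu0 x hx, Real.zero_rpow hp0.ne']
  have hB0 : ∀ x ∉ tsupport u, B x = 0 := fun x hx => by
    simp [hB, hfu0 x hx, Real.zero_rpow hp0.ne']
  have hD0 : ∀ x ∉ tsupport u, D x = 0 := fun x hx => by simp [hD, hff0 x hx]
  have hhz : ∀ x ∉ tsupport u, h =ᶠ[nhds x] fun _ => 0 := fun x hx => by
    filter_upwards [hK.isClosed.isOpen_compl.mem_nhds hx] with y hy using hh0 y hy
  have hhC : ContDiff ℝ 1 h := by
    rw [contDiff_iff_contDiffAt]
    intro x
    by_cases hx : x ∈ tsupport u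
    · exact hfc.contDiffAt.mul ((hnr _ x (hts hx)).mul (hlr _ x (hts hx)))
    · exact contDiffAt_const.congr_of_eventuallyEq (hhz x hx)
  have hhs : HasCompactSupport h := HasCompactSupport.intro hK hh0
  have hhi : Integrable h := hhC.continuous.integrable_of_hasCompactSupport hhs
  have hAi : Integrable A := hle_continuous hK hts A hA0 fun x hx =>
    (hfc.continuous.continuousAt.mul (hnr _ x hx).continuousAt).mul (hlr _ x hx).continuousAt
  have hDi : Integrable D := hle_continuous hK hts D hD0 fun x hx =>
    (hff.clm_apply continuous_id).continuousAt.mul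
      ((hnr _ x hx).continuousAt.mul (hlr _ x hx).continuousAt)
  have hBi : Integrable B := hle_continuous hK hts B hB0 fun x hx => by
    refine ContinuousAt.mul (ContinuousAt.mul ?_ (hlr _ x hx).continuousAt)
      (hnr _ x hx).continuousAt
    refine ContinuousAt.rpow_const (ContinuousAt.norm ?_) (Or.inr hp0.le)
    refine hfu.continuousAt.clm_apply ?_
    exact ((hnC x hx).continuousAt.inv₀ (hΩ0 hx).1.ne').smul continuousAt_id
  have hpt : ∀ x, fderiv ℝ h x x = D x - N * h x - (θ + 1) * A x := by
    intro x
    by_cases hx : x ∈ tsupport u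
    · exact hle_radial θ f x (hΩ0 (hts hx)).1 (hΩ0 (hts hx)).2 (hfd x)
        (hhC.differentiable one_ne_zero x)
    · rw [(hhz x hx).fderiv_eq, hh0 x hx, hA0 x hx, hD0 x hx]
      simp
  have hID : ∫ x, D x = (θ + 1) * ∫ x, A x := by
    have e := hle_euler h hhC hhs
    simp_rw [hpt] at e
    rw [integral_sub (f := fun x => D x - N * h x) (hDi.sub (hhi.const_mul _))
      (hAi.const_mul _),
      integral_sub hDi (hhi.const_mul _), integral_const_mul, integral_const_mul] at e
    linarith
  have hSA : ∫ x in Ω, A x = ∫ x, A x :=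
    setIntegral_eq_integral_of_forall_compl_eq_zero fun x hx => hA0 x fun h => hx (hts h)
  have hSB : ∫ x in Ω, B x = ∫ x, B x :=
    setIntegral_eq_integral_of_forall_compl_eq_zero fun x hx => hB0 x fun h => hx (hts h)
  rw [hSA, hSB]
  have ha0 : 0 ≤ a := abs_nonneg _
  have hBnn : ∀ x, 0 ≤ B x := by
    intro x
    by_cases hx : x ∈ tsupport u
    · have := hlog x (hts hx)
      simp only [hB]
      positivity
    · exact (hB0 x hx).ge
  rcases ha0.eq_or_lt with ha1 | ha1
  · rw [← ha1, Real.zero_rpow hp0.ne', zero_mul]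
    exact integral_nonneg hBnn
  have hkey : ∀ x, a ^ (p - 1) * |D x| ≤ (p - 1) * a ^ p * A x + B x := by
    intro x
    by_cases hx : x ∈ tsupport u
    swap
    · rw [hD0 x hx, hA0 x hx, hB0 x hx]; simp
    have hr := (hΩ0 (hts hx)).1
    have hl := hlog x (hts hx)
    have hgx : fderiv ℝ u x x = ‖x‖ • fderiv ℝ u x (‖x‖⁻¹ • x) := by
      rw [← map_smul, smul_smul, mul_inv_cancel₀ hr.ne', one_smul]
    have hfb : |fderiv ℝ f x x| ≤
        p * (‖u x‖ ^ (p - 1) * (‖x‖ * ‖fderiv ℝ u x (‖x‖⁻¹ • x)‖)) := by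
      have h1 : |inner ℝ (u x) (fderiv ℝ u x x)| ≤ ‖u x‖ * ‖fderiv ℝ u x x‖ :=
        abs_real_inner_le_norm _ _
      have h2 : ‖u x‖ ^ (p - 1) = ‖u x‖ ^ (p - 2) * ‖u x‖ := by
        rw [← Real.rpow_add_one' (norm_nonneg _) (by linarith)]
        congr 1; ring
      have h3 : ‖x‖ * ‖fderiv ℝ u x (‖x‖⁻¹ • x)‖ = ‖fderiv ℝ u x x‖ := by
        rw [hgx, norm_smul, norm_norm]
      rw [h3, h2, hff' x]
      simp only [_root_.smul_apply, ContinuousLinearMap.comp_apply,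
        innerSL_apply_apply, smul_eq_mul]
      rw [abs_mul, abs_of_nonneg (by positivity : 0 ≤ p * ‖u x‖ ^ (p - 2))]
      calc _ ≤ p * ‖u x‖ ^ (p - 2) * (‖u x‖ * ‖fderiv ℝ u x x‖) := by gcongr
        _ = _ := by ring
    simp only [hA, hB, hD]
    set G := ‖fderiv ℝ u x (‖x‖⁻¹ • x)‖ with hG
    set l := Real.log (R / ‖x‖) with hl'
    set r := ‖x‖ with hr'
    have hG0 : 0 ≤ G := norm_nonneg _
    have hy := hle_young (s := ‖u x‖) (y := r * G * l) hp ha1 (norm_nonneg _) (by positivity)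
    have hq : 0 < r ^ (-(N : ℝ)) * l ^ θ := by positivity
    have hy2 := mul_le_mul_of_nonneg_right hy hq.le
    rw [Real.mul_rpow (by positivity) hl.le, Real.mul_rpow hr.le hG0] at hy2
    have e1 : r ^ (-((N : ℝ) - p)) = r ^ (-(N : ℝ)) * r ^ p := by
      rw [← Real.rpow_add hr]; congr 1; ring
    rw [e1, Real.rpow_add hl θ p, Real.rpow_add_one hl.ne', abs_mul,
      abs_of_pos (by positivity : 0 < r ^ (-(N : ℝ)) * (l ^ θ * l))]
    calc a ^ (p - 1) * (|fderiv ℝ f x x| * (r ^ (-(N : ℝ)) * (l ^ θ * l)))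
        ≤ a ^ (p - 1) * (p * (‖u x‖ ^ (p - 1) * (r * G)) * (r ^ (-(N : ℝ)) * (l ^ θ * l))) := by
          gcongr
      _ = p * a ^ (p - 1) * (‖u x‖ ^ (p - 1) * (r * G * l)) * (r ^ (-(N : ℝ)) * l ^ θ) := by ring
      _ ≤ _ := hy2
      _ = _ := by ring
  have hint := integral_mono (hDi.abs.const_mul (a ^ (p - 1)))
    ((hAi.const_mul ((p - 1) * a ^ p)).add hBi) hkey
  simp only [Pi.add_apply] at hint
  rw [integral_add (hAi.const_mul _) hBi, integral_const_mul, integral_const_mul] at hint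
  have hDabs : |θ + 1| * ∫ x, A x ≤ ∫ x, |D x| := by
    have h1 : |∫ x, D x| ≤ ∫ x, |D x| := abs_integral_le_integral_abs
    rw [hID, abs_mul] at h1
    exact (mul_le_mul_of_nonneg_left (le_abs_self _) (abs_nonneg _)).trans h1
  have hap : |θ + 1| = p * a := by
    rw [ha, abs_div, abs_of_pos hp0]; field_simp
  have hapow : a ^ p = a ^ (p - 1) * a := by
    rw [← Real.rpow_add_one ha1.ne']; congr 1; ring
  have h5 := mul_le_mul_of_nonneg_left hDabs (Real.rpow_nonneg ha0 (p - 1))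
  have h6 : a ^ (p - 1) * (|θ + 1| * ∫ x, A x) = p * (a ^ p * ∫ x, A x) := by
    rw [hap, hapow]; ring
  rw [h6] at h5
  have h7 := h5.trans hint
  linarith
end
end

section
/- Let N ≥ 1, let p ≥ 2 be a real number, and let α, β be real constants with α ≥ 2 and β > 0. Then for every u ∈ C^∞_c(ℝ^N;ℂ): ∫_{ℝ^N} |∇u(x)·(x/|x|)|^p e^{−|x|^α/β} dx ≥ (α/(pβ))^p ∫_{ℝ^N} |u(x)|^p |x|^{p(α−1)} e^{−|x|^α/β} dx − (α/(pβ))^{p−1} (α(p−1) + N − p) ∫_{ℝ^N} |u(x)|^p |x|^{α(p−1)−p} e^{−|x|^α/β} dx. -/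
open MeasureTheory Real

noncomputable section

/-- Elementary form of Young's inequality. -/
theorem young_aux_s10 {p a b : ℝ} (hp : 2 ≤ p) (ha : 0 ≤ a) (hb : 0 ≤ b) :
    p * a * b ^ (p - 1) ≤ a ^ p + (p - 1) * b ^ p := by
  have hp1 : 1 < p := by linarith
  have h := Real.young_inequality_of_nonneg ha (Real.rpow_nonneg hb (p - 1))
    (Real.HolderConjugate.conjExponent hp1)
  have e : (b ^ (p - 1)) ^ (p.conjExponent) = b ^ p := by
    rw [← Real.rpow_mul hb]
    congr 1
    unfold Real.conjExponent
    have : p - 1 ≠ 0 := by linarith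
    field_simp
  rw [e] at h
  unfold Real.conjExponent at h
  have hp0 : 0 < p := by linarith
  have h2 := mul_le_mul_of_nonneg_left h hp0.le
  have h3 : p * (a ^ p / p + b ^ p / (p / (p - 1))) = a ^ p + (p - 1) * b ^ p := by
    have : p - 1 ≠ 0 := by linarith
    field_simp
  rw [h3] at h2
  linarith

/-- The integral of a directional derivative of an integrable function vanishes. -/
theorem integral_lineDeriv_zero {N : ℕ} (G G' : EuclideanSpace ℝ (Fin N) → ℝ)
    (v : EuclideanSpace ℝ (Fin N))
    (hG : Integrable G) (hG' : Integrable G') (h : ∀ x, HasLineDerivAt ℝ G (G' x) x v) :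
    ∫ x, G' x = 0 := by
  have := integral_bilinear_hasLineDerivAt_right_eq_neg_left_of_integrable
    (μ := (volume : Measure (EuclideanSpace ℝ (Fin N))))
    (f := fun _ => (1 : ℝ)) (f' := fun _ => 0) (g := G) (g' := G') (v := v)
    (B := ContinuousLinearMap.mul ℝ ℝ) (by simp) (by simpa using hG') (by simpa using hG)
    (fun x _ => by simpa [HasLineDerivAt] using hasDerivAt_const (0 : ℝ) (1 : ℝ)) (fun x _ => h x)
  simpa using this

/-- Line derivative of the coordinate times the weighted function. -/
theorem lineDeriv_formula {N : ℕ} {p α β s : ℝ} (hp : 2 ≤ p) (hα : 2 ≤ α)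
    (hs : 1 ≤ s) (u : EuclideanSpace ℝ (Fin N) → ℂ) (hu : ContDiff ℝ (⊤ : ℕ∞) u)
    (i : Fin N) (x : EuclideanSpace ℝ (Fin N)) :
    HasLineDerivAt ℝ
      (fun x => x i * (‖u x‖ ^ p * (‖x‖ ^ (s - 1) * Real.exp (-(‖x‖ ^ α) / β))))
      (‖u x‖ ^ p * (‖x‖ ^ (s - 1) * Real.exp (-(‖x‖ ^ α) / β))
        + (p * ‖u x‖ ^ (p - 2) * inner ℝ (u x) (x i • fderiv ℝ u x (EuclideanSpace.single i 1)))
            * (‖x‖ ^ (s - 1) * Real.exp (-(‖x‖ ^ α) / β))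
        + (‖u x‖ ^ p * (((s - 1) - α / β * ‖x‖ ^ α)
            * (‖x‖ ^ (s - 1) * Real.exp (-(‖x‖ ^ α) / β)))) * ((x i) ^ 2 / ‖x‖ ^ 2))
      x (EuclideanSpace.single i 1) := by
  have hud : Differentiable ℝ u := hu.differentiable (by simp)
  set e : EuclideanSpace ℝ (Fin N) := EuclideanSpace.single i 1 with he
  have hline : HasDerivAt (fun t : ℝ => x + t • e) e 0 := by
    simpa using ((hasDerivAt_id (0 : ℝ)).smul_const e).const_add x
  have hx0 : x + (0 : ℝ) • e = x := by simp
  have hcoord : HasDerivAt (fun t : ℝ => (x + t • e) i) 1 0 := by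
    have : (fun t : ℝ => (x + t • e) i) = fun t => x i + t := by
      ext t; simp [he]
    rw [this]
    simpa using (hasDerivAt_id (0 : ℝ)).const_add (x i)
  unfold HasLineDerivAt
  by_cases hx : x = 0
  · subst hx
    have hc : Continuous (fun t : ℝ =>
        ‖u (0 + t • e)‖ ^ p * (‖0 + t • e‖ ^ (s - 1) * Real.exp (-(‖0 + t • e‖ ^ α) / β))) := by
      have h1 : Continuous (fun t : ℝ => (0 : EuclideanSpace ℝ (Fin N)) + t • e) := by fun_prop
      have h2 : Continuous (fun t : ℝ => u (0 + t • e)) := hu.continuous.comp h1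
      refine (h2.norm.rpow_const (fun _ => Or.inr (by linarith))).mul
        ((h1.norm.rpow_const (fun _ => Or.inr (by linarith))).mul ?_)
      exact Real.continuous_exp.comp
        ((h1.norm.rpow_const (fun _ => Or.inr (by linarith))).neg.div_const β)
    rw [hasDerivAt_iff_tendsto_slope]
    have ht := (hc.tendsto 0).mono_left (nhdsWithin_le_nhds (s := {(0 : ℝ)}ᶜ))
    simp only [PiLp.zero_apply, zero_smul, inner_zero_right, mul_zero, zero_mul, add_zero,
      ne_eq, OfNat.ofNat_ne_zero, not_false_eq_true, zero_pow, zero_div] at ht ⊢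
    refine ht.congr' ?_
    filter_upwards [self_mem_nhdsWithin] with t ht
    have ht0 : t ≠ 0 := ht
    simp only [slope_def_field, he]
    simp
    field_simp
  · have hxn : 0 < ‖x‖ := norm_pos_iff.mpr hx
    have hinner : inner ℝ x e = x i := by
      simp [he, EuclideanSpace.inner_single_right]
    have hU : HasDerivAt (fun t : ℝ => u (x + t • e)) (fderiv ℝ u x e) 0 := by
      have h := (hud x).hasFDerivAt
      rw [← hx0] at h
      have h2 := h.comp_hasDerivAt (0 : ℝ) hline
      rw [hx0] at h2
      exact h2
    have hUp : HasDerivAt (fun t : ℝ => ‖u (x + t • e)‖ ^ p)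
        (p * ‖u x‖ ^ (p - 2) * inner ℝ (u x) (fderiv ℝ u x e)) 0 := by
      have h := hasFDerivAt_norm_rpow (u x) (p := p) (by linarith)
      have hux : u x = u (x + (0 : ℝ) • e) := by rw [hx0]
      have h' := h
      rw [hux] at h'
      have h2 := h'.comp_hasDerivAt (0 : ℝ) hU
      simpa [hx0, Function.comp_def, mul_assoc] using h2
    have hA : HasDerivAt (fun t : ℝ => ‖x + t • e‖ ^ α)
        (α * ‖x‖ ^ (α - 2) * x i) 0 := by
      have h := hasFDerivAt_norm_rpow x (p := α) (by linarith)
      have h' := h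
      rw [← hx0] at h'
      have h2 := h'.comp_hasDerivAt (0 : ℝ) hline
      simpa [hx0, hinner, Function.comp_def, mul_assoc] using h2
    have hS : HasDerivAt (fun t : ℝ => ‖x + t • e‖ ^ (s - 1))
        ((s - 1) * ‖x‖ ^ (s - 3) * x i) 0 := by
      have hsq : HasDerivAt (fun t : ℝ => ‖x + t • e‖ ^ 2) (2 * x i) 0 := by
        have h2 := hline.norm_sq
        simpa [hx0, hinner] using h2
      have h3 := hsq.rpow_const (p := (s - 1) / 2) (Or.inl (by simp [hx]))
      have e1 : (fun t : ℝ => (‖x + t • e‖ ^ 2) ^ ((s - 1) / 2))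
          = fun t : ℝ => ‖x + t • e‖ ^ (s - 1) := by
        ext t
        rw [← Real.rpow_natCast, ← Real.rpow_mul (norm_nonneg _)]
        congr 1
        push_cast; ring
      rw [e1] at h3
      convert h3 using 1
      rw [hx0, ← Real.rpow_natCast, ← Real.rpow_mul (norm_nonneg _)]
      have : ((2 : ℕ) : ℝ) * ((s - 1) / 2 - 1) = s - 3 := by push_cast; ring
      rw [this]; ring
    have hE := (hA.neg.div_const β).exp
    have hfin := hcoord.mul (hUp.mul (hS.mul hE))
    refine HasDerivAt.congr_deriv hfin ?_
    have e2 : ‖x‖ ^ (s - 3) = ‖x‖ ^ (s - 1) / ‖x‖ ^ 2 := by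
      rw [← Real.rpow_natCast, ← Real.rpow_sub hxn]; congr 1; push_cast; ring
    have e3 : ‖x‖ ^ (α - 2) = ‖x‖ ^ α / ‖x‖ ^ 2 := by
      rw [← Real.rpow_natCast, ← Real.rpow_sub hxn]; congr 1
    simp only [Pi.neg_apply, hx0, e2, e3, inner_smul_right, Pi.mul_apply]
    ring

/-- Integration by parts. -/
theorem ibp_radial {N : ℕ} (hN : 1 ≤ N) {p α β s : ℝ} (hp : 2 ≤ p) (hα : 2 ≤ α)
    (hs : 1 ≤ s) (u : EuclideanSpace ℝ (Fin N) → ℂ) (hu : ContDiff ℝ (⊤ : ℕ∞) u)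
    (hc : HasCompactSupport u) :
    (N : ℝ) * (∫ x, ‖u x‖ ^ p * (‖x‖ ^ (s - 1) * Real.exp (-(‖x‖ ^ α) / β)))
    + (∫ x, (p * ‖u x‖ ^ (p - 2) * inner ℝ (u x) (fderiv ℝ u x x))
            * (‖x‖ ^ (s - 1) * Real.exp (-(‖x‖ ^ α) / β)))
    + (∫ x, (‖u x‖ ^ p * (((s - 1) - α / β * ‖x‖ ^ α)
            * (‖x‖ ^ (s - 1) * Real.exp (-(‖x‖ ^ α) / β))))) = 0 := by
  have hp0 : p ≠ 0 := by linarith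
  have hucont := hu.continuous
  have hDu : Continuous (fderiv ℝ u) := hu.continuous_fderiv (by simp)
  have hn1 : Continuous (fun x : EuclideanSpace ℝ (Fin N) => ‖x‖ ^ (s - 1)) :=
    continuous_norm.rpow_const (fun _ => Or.inr (by linarith))
  have hnα : Continuous (fun x : EuclideanSpace ℝ (Fin N) => ‖x‖ ^ α) :=
    continuous_norm.rpow_const (fun _ => Or.inr (by linarith))
  have hup : Continuous (fun x => ‖u x‖ ^ p) :=
    hucont.norm.rpow_const (fun _ => Or.inr (by linarith))
  have hup2 : Continuous (fun x => ‖u x‖ ^ (p - 2)) :=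
    hucont.norm.rpow_const (fun _ => Or.inr (by linarith))
  have cs : ∀ f : EuclideanSpace ℝ (Fin N) → ℝ, (∀ x, u x = 0 → f x = 0) →
      HasCompactSupport f := by
    intro f hf
    refine hc.mono ?_
    intro x hx hux
    exact hx (hf x hux)
  have ig : Integrable (fun x => ‖u x‖ ^ p * (‖x‖ ^ (s - 1) * Real.exp (-(‖x‖ ^ α) / β))) :=
    Continuous.integrable_of_hasCompactSupport (by fun_prop)
      (cs _ (fun x hx => by simp [hx, Real.zero_rpow hp0]))
  have iB : Integrable (fun x => ‖u x‖ ^ p * (((s - 1) - α / β * ‖x‖ ^ α)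
            * (‖x‖ ^ (s - 1) * Real.exp (-(‖x‖ ^ α) / β)))) :=
    Continuous.integrable_of_hasCompactSupport (by fun_prop)
      (cs _ (fun x hx => by simp [hx, Real.zero_rpow hp0]))
  have iG : ∀ i : Fin N, Integrable
      (fun x => x i * (‖u x‖ ^ p * (‖x‖ ^ (s - 1) * Real.exp (-(‖x‖ ^ α) / β)))) := fun i =>
    Continuous.integrable_of_hasCompactSupport (by fun_prop)
      (cs _ (fun x hx => by simp [hx, Real.zero_rpow hp0]))
  have iA : ∀ i : Fin N, Integrable (fun x =>
      (p * ‖u x‖ ^ (p - 2) * inner ℝ (u x) (x i • fderiv ℝ u x (EuclideanSpace.single i 1)))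
            * (‖x‖ ^ (s - 1) * Real.exp (-(‖x‖ ^ α) / β))) := fun i =>
    Continuous.integrable_of_hasCompactSupport (by fun_prop)
      (cs _ (fun x hx => by simp [hx]))
  have iB' : ∀ i : Fin N, Integrable (fun x => (‖u x‖ ^ p * (((s - 1) - α / β * ‖x‖ ^ α)
            * (‖x‖ ^ (s - 1) * Real.exp (-(‖x‖ ^ α) / β)))) * ((x i) ^ 2 / ‖x‖ ^ 2)) := by
    intro i
    refine iB.mul_bdd (c := 1) ?_ ?_
    · refine Measurable.aestronglyMeasurable ?_
      fun_prop
    · refine Filter.Eventually.of_forall (fun x => ?_)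
      rw [Real.norm_of_nonneg (by positivity)]
      refine div_le_one_of_le₀ ?_ (by positivity)
      have := PiLp.norm_apply_le x i
      rw [Real.norm_eq_abs] at this
      rw [← sq_abs]
      gcongr
  have key := fun i : Fin N => integral_lineDeriv_zero _ _ _ (iG i) ((ig.add (iA i)).add (iB' i))
    (lineDeriv_formula (β := β) hp hα hs u hu i)
  have hsum : ∑ i : Fin N, ∫ x,
      (‖u x‖ ^ p * (‖x‖ ^ (s - 1) * Real.exp (-(‖x‖ ^ α) / β))
        + (p * ‖u x‖ ^ (p - 2) * inner ℝ (u x) (x i • fderiv ℝ u x (EuclideanSpace.single i 1)))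
            * (‖x‖ ^ (s - 1) * Real.exp (-(‖x‖ ^ α) / β))
        + (‖u x‖ ^ p * (((s - 1) - α / β * ‖x‖ ^ α)
            * (‖x‖ ^ (s - 1) * Real.exp (-(‖x‖ ^ α) / β)))) * ((x i) ^ 2 / ‖x‖ ^ 2)) = 0 :=
    Finset.sum_eq_zero (fun i _ => key i)
  rw [← integral_finsetSum _ (fun i _ => by exact (ig.add (iA i)).add (iB' i))] at hsum
  have iAA : Integrable (fun x => (p * ‖u x‖ ^ (p - 2) * inner ℝ (u x) (fderiv ℝ u x x))
            * (‖x‖ ^ (s - 1) * Real.exp (-(‖x‖ ^ α) / β))) :=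
    Continuous.integrable_of_hasCompactSupport (by fun_prop)
      (cs _ (fun x hx => by simp [hx]))
  rw [← integral_const_mul, ← integral_add (ig.const_mul _) iAA,
    ← integral_add (by exact (ig.const_mul _).add iAA) iB]
  rw [← hsum]
  have : Nonempty (Fin N) := ⟨⟨0, hN⟩⟩
  have : Nontrivial (EuclideanSpace ℝ (Fin N)) := inferInstance
  refine integral_congr_ae ?_
  have hae : ∀ᵐ x : EuclideanSpace ℝ (Fin N), x ≠ 0 := by
    simp [ae_iff, measure_singleton]
  filter_upwards [hae] with x hx
  have hxn : 0 < ‖x‖ := norm_pos_iff.mpr hx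
  simp only [Finset.sum_add_distrib, Finset.sum_const]
  rw [← Finset.sum_mul, ← Finset.mul_sum, ← Finset.mul_sum, ← inner_sum, ← Finset.sum_div]
  have e1 : ∑ i, (x i) ^ 2 = ‖x‖ ^ 2 := by
    rw [EuclideanSpace.real_norm_sq_eq]
  have e2 : ∑ i, x i • fderiv ℝ u x (EuclideanSpace.single i 1) = fderiv ℝ u x x := by
    simp only [← map_smul, ← map_sum]
    congr 1
    ext j
    simp [Finset.sum_apply, Pi.single_apply]
  rw [e1, e2, div_self (by positivity)]
  simp

/-- **Gaussian-type Hardy inequality (type A) in `ℝ^N`** with weight `e^{-|x|^α/β}`. -/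
theorem hardy_gaussian_A_euclidean
    {N : ℕ} (hN : 1 ≤ N)
    {p : ℝ} (hp : 2 ≤ p)
    {α β : ℝ} (hα : 2 ≤ α) (hβ : 0 < β) :
    ∀ u : EuclideanSpace ℝ (Fin N) → ℂ,
      ContDiff ℝ (⊤ : ℕ∞) u → HasCompactSupport u →
      (α / (p * β)) ^ p *
          (∫ x, ‖u x‖ ^ p * ‖x‖ ^ (p * (α - 1)) * Real.exp (-(‖x‖ ^ α) / β))
        - (α / (p * β)) ^ (p - 1) * (α * (p - 1) + (N : ℝ) - p) *
          (∫ x, ‖u x‖ ^ p * ‖x‖ ^ (α * (p - 1) - p) * Real.exp (-(‖x‖ ^ α) / β))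
        ≤ ∫ x, ‖fderiv ℝ u x (‖x‖⁻¹ • x)‖ ^ p * Real.exp (-(‖x‖ ^ α) / β) := by
  intro u hu hc
  have hp0 : p ≠ 0 := by linarith
  have hppos : 0 < p := by linarith
  set s : ℝ := (α - 1) * (p - 1) with hsdef
  have hs : 1 ≤ s := by nlinarith
  have hsexp : α * (p - 1) - p = s - 1 := by rw [hsdef]; ring
  have hib := ibp_radial (β := β) hN hp hα hs u hu hc
  rw [hsexp]
  set c : ℝ := α / (p * β) with hcdef
  have hcpos : 0 < c := by positivity
  have hucont := hu.continuous
  have hDu : Continuous (fderiv ℝ u) := hu.continuous_fderiv (by simp)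
  have hn1 : Continuous (fun x : EuclideanSpace ℝ (Fin N) => ‖x‖ ^ (s - 1)) :=
    continuous_norm.rpow_const (fun _ => Or.inr (by linarith))
  have hnα : Continuous (fun x : EuclideanSpace ℝ (Fin N) => ‖x‖ ^ α) :=
    continuous_norm.rpow_const (fun _ => Or.inr (by linarith))
  have hnpα : Continuous (fun x : EuclideanSpace ℝ (Fin N) => ‖x‖ ^ (p * (α - 1))) :=
    continuous_norm.rpow_const (fun _ => Or.inr (by nlinarith))
  have hup : Continuous (fun x => ‖u x‖ ^ p) :=
    hucont.norm.rpow_const (fun _ => Or.inr (by linarith))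
  have hup2 : Continuous (fun x => ‖u x‖ ^ (p - 2)) :=
    hucont.norm.rpow_const (fun _ => Or.inr (by linarith))
  have hDup : Continuous (fun x => ‖fderiv ℝ u x‖ ^ p) :=
    hDu.norm.rpow_const (fun _ => Or.inr (by linarith))
  have cs : ∀ f : EuclideanSpace ℝ (Fin N) → ℝ, (∀ x, u x = 0 → f x = 0) →
      HasCompactSupport f := by
    intro f hf
    refine hc.mono ?_
    intro x hx hux
    exact hx (hf x hux)
  have i1 : Integrable
      (fun x => ‖u x‖ ^ p * ‖x‖ ^ (p * (α - 1)) * Real.exp (-(‖x‖ ^ α) / β)) :=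
    Continuous.integrable_of_hasCompactSupport (by fun_prop)
      (cs _ (fun x hx => by simp [hx, Real.zero_rpow hp0]))
  have i2 : Integrable
      (fun x => ‖u x‖ ^ p * ‖x‖ ^ (s - 1) * Real.exp (-(‖x‖ ^ α) / β)) :=
    Continuous.integrable_of_hasCompactSupport (by fun_prop)
      (cs _ (fun x hx => by simp [hx, Real.zero_rpow hp0]))
  have iAA : Integrable (fun x => (p * ‖u x‖ ^ (p - 2) * inner ℝ (u x) (fderiv ℝ u x x))
            * (‖x‖ ^ (s - 1) * Real.exp (-(‖x‖ ^ α) / β))) :=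
    Continuous.integrable_of_hasCompactSupport (by fun_prop)
      (cs _ (fun x hx => by simp [hx]))
  have iD : Integrable (fun x => ‖fderiv ℝ u x‖ ^ p * Real.exp (-(‖x‖ ^ α) / β)) := by
    refine Continuous.integrable_of_hasCompactSupport (by fun_prop) ?_
    refine (hc.fderiv (𝕜 := ℝ)).mono ?_
    intro x hx h0
    exact hx (by simp [h0, Real.zero_rpow hp0])
  have iJ : Integrable
      (fun x => ‖fderiv ℝ u x (‖x‖⁻¹ • x)‖ ^ p * Real.exp (-(‖x‖ ^ α) / β)) := by
    refine iD.mono' ?_ ?_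
    · refine Measurable.aestronglyMeasurable ?_
      have : Measurable (fun x => fderiv ℝ u x (‖x‖⁻¹ • x)) := by
        have h1 : Continuous (fun x => fderiv ℝ u x x) := by fun_prop
        have h2 : (fun x => fderiv ℝ u x (‖x‖⁻¹ • x)) = fun x => ‖x‖⁻¹ • fderiv ℝ u x x := by
          ext x; simp
        rw [h2]
        exact (measurable_norm.inv).smul h1.measurable
      exact (this.norm.pow_const p).mul (by fun_prop)
    · refine Filter.Eventually.of_forall (fun x => ?_)
      rw [Real.norm_of_nonneg (by positivity)]
      gcongr
      refine (ContinuousLinearMap.le_opNorm _ _).trans ?_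
      refine mul_le_of_le_one_right (norm_nonneg _) ?_
      rw [norm_smul, norm_inv, norm_norm]
      exact inv_mul_le_one
  -- rewrite the identity
  have hB : (∫ x, (‖u x‖ ^ p * (((s - 1) - α / β * ‖x‖ ^ α)
            * (‖x‖ ^ (s - 1) * Real.exp (-(‖x‖ ^ α) / β)))))
      = (s - 1) * (∫ x, ‖u x‖ ^ p * ‖x‖ ^ (s - 1) * Real.exp (-(‖x‖ ^ α) / β))
        - α / β * (∫ x, ‖u x‖ ^ p * ‖x‖ ^ (p * (α - 1)) * Real.exp (-(‖x‖ ^ α) / β)) := by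
    rw [← integral_const_mul, ← integral_const_mul,
      ← integral_sub (i2.const_mul _) (i1.const_mul _)]
    congr 1
    ext x
    have : ‖x‖ ^ (p * (α - 1)) = ‖x‖ ^ α * ‖x‖ ^ (s - 1) := by
      rw [← Real.rpow_add_of_nonneg (norm_nonneg _) (by linarith) (by linarith)]
      congr 1; rw [hsdef]; ring
    rw [this]; ring
  have hg : (∫ x, ‖u x‖ ^ p * (‖x‖ ^ (s - 1) * Real.exp (-(‖x‖ ^ α) / β)))
      = ∫ x, ‖u x‖ ^ p * ‖x‖ ^ (s - 1) * Real.exp (-(‖x‖ ^ α) / β) := by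
    simp only [mul_assoc]
  rw [hB, hg] at hib
  have hmono : c ^ (p - 1) * (∫ x, (p * ‖u x‖ ^ (p - 2) * inner ℝ (u x) (fderiv ℝ u x x))
            * (‖x‖ ^ (s - 1) * Real.exp (-(‖x‖ ^ α) / β)))
      ≤ (∫ x, ‖fderiv ℝ u x (‖x‖⁻¹ • x)‖ ^ p * Real.exp (-(‖x‖ ^ α) / β))
        + (p - 1) * c ^ p *
          (∫ x, ‖u x‖ ^ p * ‖x‖ ^ (p * (α - 1)) * Real.exp (-(‖x‖ ^ α) / β)) := by
    rw [← integral_const_mul, ← integral_const_mul, ← integral_add iJ (i1.const_mul _)]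
    refine integral_mono (iAA.const_mul _) (iJ.add (i1.const_mul _)) (fun x => ?_)
    simp only
    set w := Real.exp (-(‖x‖ ^ α) / β) with hw
    have hwpos : 0 < w := Real.exp_pos _
    set a := ‖fderiv ℝ u x (‖x‖⁻¹ • x)‖ with ha
    have ha0 : 0 ≤ a := norm_nonneg _
    have hxa : ‖fderiv ℝ u x x‖ = ‖x‖ * a := by
      by_cases hx : x = 0
      · simp [hx]
      · have hxn : ‖x‖ ≠ 0 := norm_ne_zero_iff.mpr hx
        rw [ha, map_smul, norm_smul, norm_inv, norm_norm]
        field_simp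
    have hY := young_aux_s10 (p := p) (a := a) (b := c * ‖x‖ ^ (α - 1) * ‖u x‖) hp ha0
      (by positivity)
    have eb : ∀ q : ℝ, (c * ‖x‖ ^ (α - 1) * ‖u x‖) ^ q
        = c ^ q * ‖x‖ ^ ((α - 1) * q) * ‖u x‖ ^ q := by
      intro q
      rw [Real.mul_rpow (by positivity) (by positivity),
        Real.mul_rpow (by positivity) (by positivity), ← Real.rpow_mul (norm_nonneg _)]
    rw [eb, eb, ← hsdef] at hY
    have hin : inner ℝ (u x) (fderiv ℝ u x x) ≤ ‖u x‖ * (‖x‖ * a) := by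
      rw [← hxa]; exact real_inner_le_norm _ _
    have eu : ‖u x‖ ^ (p - 1) = ‖u x‖ ^ (p - 2) * ‖u x‖ := by
      conv_rhs => rw [← Real.rpow_one ‖u x‖, ← Real.rpow_mul (norm_nonneg _)]
      rw [one_mul, ← Real.rpow_add_of_nonneg (norm_nonneg _) (by linarith) (by norm_num)]
      congr 1; ring
    have ex : ‖x‖ ^ s = ‖x‖ ^ (s - 1) * ‖x‖ := by
      conv_rhs => rw [← Real.rpow_one ‖x‖, ← Real.rpow_mul (norm_nonneg _)]
      rw [one_mul, ← Real.rpow_add_of_nonneg (norm_nonneg _) (by linarith) (by norm_num)]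
      congr 1; ring
    calc c ^ (p - 1) * (p * ‖u x‖ ^ (p - 2) * inner ℝ (u x) (fderiv ℝ u x x)
            * (‖x‖ ^ (s - 1) * w))
        ≤ c ^ (p - 1) * (p * ‖u x‖ ^ (p - 2) * (‖u x‖ * (‖x‖ * a))
            * (‖x‖ ^ (s - 1) * w)) := by gcongr
      _ = (p * a * (c ^ (p - 1) * ‖x‖ ^ s * ‖u x‖ ^ (p - 1))) * w := by
          rw [eu, ex]; ring
      _ ≤ (a ^ p + (p - 1) * (c ^ p * ‖x‖ ^ ((α - 1) * p) * ‖u x‖ ^ p)) * w := by gcongr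
      _ = _ := by rw [mul_comm (α - 1) p]; ring
  have hcp : c ^ p = c ^ (p - 1) * c := by
    rw [← Real.rpow_add_one hcpos.ne']; congr 1; ring
  have hαβ : α / β = p * c := by rw [hcdef]; field_simp
  rw [hαβ] at hib
  set I1 := ∫ x, ‖u x‖ ^ p * ‖x‖ ^ (p * (α - 1)) * Real.exp (-(‖x‖ ^ α) / β)
  set I2 := ∫ x, ‖u x‖ ^ p * ‖x‖ ^ (s - 1) * Real.exp (-(‖x‖ ^ α) / β)
  set J := ∫ x, ‖fderiv ℝ u x (‖x‖⁻¹ • x)‖ ^ p * Real.exp (-(‖x‖ ^ α) / β)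
  set A := ∫ x, (p * ‖u x‖ ^ (p - 2) * inner ℝ (u x) (fderiv ℝ u x x))
            * (‖x‖ ^ (s - 1) * Real.exp (-(‖x‖ ^ α) / β))
  have hA : A = p * c * I1 - (s - 1 + N) * I2 := by linarith
  rw [hA] at hmono
  have hN' : α * (p - 1) + (N : ℝ) - p = s - 1 + N := by linarith
  rw [hN']
  rw [hcp] at hmono ⊢
  nlinarith [hmono]
end
end

section
/- Let N ≥ 1, let θ ∈ ℝ, let 0 < a < b, and let Ω_{a,b} = {x ∈ ℝ^N : a < |x| < b}. Then for every u ∈ C^∞_c(Ω_{a,b};ℂ): ∫_{Ω_{a,b}} |∇u(x)·(x/|x|)|² |x|^{−2(θ−1)} dx ≥ [((N − 2θ)/2)² + (π/log(b/a))²] ∫_{Ω_{a,b}} |u(x)|² |x|^{−2θ} dx. -/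
open MeasureTheory Real

noncomputable section

lemma euler_integral {N : ℕ} (h : EuclideanSpace ℝ (Fin N) → ℝ) (hc : ContDiff ℝ 1 h)
    (hs : HasCompactSupport h) :
    Integrable (fun x => fderiv ℝ h x x + N * h x) ∧
    ∫ x, (fderiv ℝ h x x + N * h x) = 0 := by
  have hf : Continuous (fderiv ℝ h) := hc.continuous_fderiv one_ne_zero
  have hi : Integrable h := hc.continuous.integrable_of_hasCompactSupport hs
  have key : ∀ i : Fin N,
      Integrable (fun x => fderiv ℝ h x (EuclideanSpace.single i 1) * x i + h x) ∧
      ∫ x, (fderiv ℝ h x (EuclideanSpace.single i 1) * x i + h x) = 0 := by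
    intro i
    have hp : ∀ x : EuclideanSpace ℝ (Fin N),
        HasFDerivAt (fun x : EuclideanSpace ℝ (Fin N) => x i)
          (EuclideanSpace.proj i : EuclideanSpace ℝ (Fin N) →L[ℝ] ℝ) x :=
      fun x => (EuclideanSpace.proj i : EuclideanSpace ℝ (Fin N) →L[ℝ] ℝ).hasFDerivAt
    have hp' : ∀ x : EuclideanSpace ℝ (Fin N),
        fderiv ℝ (fun x : EuclideanSpace ℝ (Fin N) => x i) x (EuclideanSpace.single i 1) = 1 := by
      intro x
      rw [(hp x).fderiv]; simp
    have i1 : Integrable (fun x => fderiv ℝ h x (EuclideanSpace.single i 1) * x i) := by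
      refine Continuous.integrable_of_hasCompactSupport (by fun_prop) ?_
      exact (hs.fderiv_apply ℝ _).mul_right
    have i2 : Integrable (fun x => h x * x i) := by
      refine Continuous.integrable_of_hasCompactSupport ?_ hs.mul_right
      have := hc.continuous
      fun_prop
    have e := integral_mul_fderiv_eq_neg_fderiv_mul_of_integrable (μ := volume) (f := h)
      (g := fun x : EuclideanSpace ℝ (Fin N) => x i) (v := EuclideanSpace.single i 1) i1
      (by simpa [hp'] using hi) i2 (fun x _ => hc.differentiable one_ne_zero x)
      (fun x _ => (hp x).differentiableAt)
    simp only [hp', mul_one] at e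
    refine ⟨i1.add hi, ?_⟩
    rw [integral_add i1 hi, e]; simp
  have hx : ∀ x : EuclideanSpace ℝ (Fin N), fderiv ℝ h x x + N * h x =
      ∑ i, (fderiv ℝ h x (EuclideanSpace.single i 1) * x i + h x) := by
    intro x
    have := (EuclideanSpace.basisFun (Fin N) ℝ).sum_repr x
    rw [Finset.sum_add_distrib]
    conv_lhs => rw [show fderiv ℝ h x x = fderiv ℝ h x
      (∑ i, ((EuclideanSpace.basisFun (Fin N) ℝ).repr x).ofLp i •
        (EuclideanSpace.basisFun (Fin N) ℝ) i) by rw [this]]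
    simp [map_sum, mul_comm]
  simp only [hx]
  refine ⟨integrable_finset_sum _ fun i _ => (key i).1, ?_⟩
  rw [integral_finset_sum _ fun i _ => (key i).1]
  simp [(key _).2]

lemma radial_deriv (k w t l r : ℝ) (hr : 0 < r) (hs : sin (w * (log r - l)) ≠ 0) :
    HasDerivAt (fun r : ℝ => (-k + w * (cos (w * (log r - l)) / sin (w * (log r - l)))) *
        r ^ (-(2 * t)))
      (r⁻¹ * ((-w ^ 2 * (1 + (cos (w * (log r - l)) / sin (w * (log r - l))) ^ 2)
        - 2 * t * (-k + w * (cos (w * (log r - l)) / sin (w * (log r - l))))) *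
        r ^ (-(2 * t)))) r := by
  have h1 : HasDerivAt (fun r : ℝ => w * (log r - l)) (w * r⁻¹) r :=
    ((hasDerivAt_log hr.ne').sub_const l).const_mul w
  have h2 := (((h1.cos.div h1.sin hs).const_mul w).const_add (-k)).mul
    (Real.hasDerivAt_rpow_const (p := -(2 * t)) (Or.inl hr.ne'))
  refine h2.congr_deriv ?_
  rw [Real.rpow_sub_one hr.ne']
  simp only [Pi.div_apply]
  field_simp
  ring

lemma pointwise_alg (u d : ℂ) (k w c t n R : ℝ) (hn : n = 2 * k + 2 * t) (hR : 0 ≤ R) :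
    (k ^ 2 + w ^ 2) * (‖u‖ ^ 2 * R) +
      ((2 * inner ℝ u d) * ((-k + w * c) * R) +
        ‖u‖ ^ 2 * ((-w ^ 2 * (1 + c ^ 2) - 2 * t * (-k + w * c)) * R) +
        n * (‖u‖ ^ 2 * ((-k + w * c) * R))) ≤ ‖d‖ ^ 2 * R := by
  have h : 0 ≤ ‖d - (-k + w * c) • u‖ ^ 2 * R := by positivity
  rw [norm_sub_sq_real, inner_smul_right, norm_smul, mul_pow, real_inner_comm,
    Real.norm_eq_abs, sq_abs] at h
  subst hn
  linarith

/-- **Sharp Hardy inequality in an annulus** (`p = 2`): on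
`Ω_{a,b} = {a < |x| < b}` one has
`∫ |∇u·(x/|x|)|² |x|^{-2(θ-1)} ≥ [((N-2θ)/2)² + (π/log(b/a))²] ∫ |u|² |x|^{-2θ}`. -/
theorem hardy_annulus_euclidean
    {N : ℕ} (hN : 1 ≤ N) (θ : ℝ)
    {a b : ℝ} (ha : 0 < a) (hab : a < b) :
    ∀ u : EuclideanSpace ℝ (Fin N) → ℂ,
      ContDiff ℝ (⊤ : ℕ∞) u → HasCompactSupport u →
      tsupport u ⊆ {x : EuclideanSpace ℝ (Fin N) | a < ‖x‖ ∧ ‖x‖ < b} →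
      ((((N : ℝ) - 2 * θ) / 2) ^ 2 + (Real.pi / Real.log (b / a)) ^ 2) *
          ∫ x in {x : EuclideanSpace ℝ (Fin N) | a < ‖x‖ ∧ ‖x‖ < b},
            ‖u x‖ ^ 2 * ‖x‖ ^ (-(2 * θ))
        ≤ ∫ x in {x : EuclideanSpace ℝ (Fin N) | a < ‖x‖ ∧ ‖x‖ < b},
            ‖fderiv ℝ u x (‖x‖⁻¹ • x)‖ ^ 2 * ‖x‖ ^ (-(2 * (θ - 1))) := by
  intro u hu hcs hsupp
  have hL : 0 < log (b / a) := log_pos ((one_lt_div ha).2 hab)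
  set w := π / log (b / a) with hw
  set k := ((N : ℝ) - 2 * θ) / 2 with hk
  have hwpos : 0 < w := div_pos pi_pos hL
  have hu1 : ContDiff ℝ 1 u := hu.of_le (by exact_mod_cast le_top)
  have hfu : Continuous (fderiv ℝ u) := hu1.continuous_fderiv one_ne_zero
  have hpos : ∀ x ∈ tsupport u, 0 < ‖x‖ := fun x hx => ha.trans (hsupp hx).1
  have hsin : ∀ x ∈ tsupport u, sin (w * (log ‖x‖ - log a)) ≠ 0 := by
    intro x hx
    have h1 := log_lt_log ha (hsupp hx).1
    have h2 := log_lt_log (hpos x hx) (hsupp hx).2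
    refine (sin_pos_of_pos_of_lt_pi (mul_pos hwpos (by linarith)) ?_).ne'
    rw [hw, div_mul_eq_mul_div, div_lt_iff₀ hL, log_div (ha.trans hab).ne' ha.ne']
    exact mul_lt_mul_of_pos_left (by linarith) pi_pos
  have hz : ∀ x ∉ tsupport u, u x = 0 := fun x hx => image_eq_zero_of_notMem_tsupport hx
  have hz' : ∀ x ∉ tsupport u, fderiv ℝ u x = 0 := fun x hx =>
    image_eq_zero_of_notMem_tsupport fun h => hx (tsupport_fderiv_subset ℝ h)
  -- compact support helper
  have cs : ∀ f : EuclideanSpace ℝ (Fin N) → ℝ, (∀ x ∉ tsupport u, f x = 0) →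
      HasCompactSupport f := fun f hf => HasCompactSupport.intro hcs hf
  have tsub : ∀ f : EuclideanSpace ℝ (Fin N) → ℝ, (∀ x ∉ tsupport u, f x = 0) →
      tsupport f ⊆ tsupport u := fun f hf =>
    closure_minimal (fun x hx => by by_contra h; exact hx (hf x h)) (isClosed_tsupport u)
  set g : ℝ → ℝ := fun r => (-k + w * (cos (w * (log r - log a)) / sin (w * (log r - log a)))) *
        r ^ (-(2 * θ)) with hg
  set h : EuclideanSpace ℝ (Fin N) → ℝ := fun x => ‖u x‖ ^ 2 * g ‖x‖ with hh
  have h0 : ∀ x ∉ tsupport u, h x = 0 := fun x hx => by simp [hh, hz x hx]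
  have hhc : ContDiff ℝ 1 h := by
    rw [contDiff_iff_contDiffAt]
    intro x
    by_cases hx : x ∈ tsupport u
    · have hp := hpos x hx
      have hxn : x ≠ 0 := norm_pos_iff.1 hp
      have hnorm : ContDiffAt ℝ 1 (fun x : EuclideanSpace ℝ (Fin N) => ‖x‖) x :=
        contDiffAt_norm ℝ hxn
      have harg : ContDiffAt ℝ 1
          (fun x : EuclideanSpace ℝ (Fin N) => w * (log ‖x‖ - log a)) x :=
        contDiffAt_const.mul ((hnorm.log hp.ne').sub contDiffAt_const)
      have hn2 : ContDiffAt ℝ 1 (fun x => ‖u x‖ ^ 2) x := hu1.contDiffAt.norm_sq ℝ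
      exact hn2.mul ((contDiffAt_const.add (contDiffAt_const.mul
        (harg.cos.div harg.sin (hsin x hx)))).mul (hnorm.rpow_const_of_ne hp.ne'))
    · have : h =ᶠ[nhds x] fun _ => 0 := by
        filter_upwards [(isClosed_tsupport u).isOpen_compl.mem_nhds hx] with y hy
        exact h0 y hy
      exact contDiffAt_const.congr_of_eventuallyEq this
  obtain ⟨hI, hE⟩ := euler_integral h hhc (cs h h0)
  rw [setIntegral_eq_integral_of_forall_compl_eq_zero
      (fun x hx => by simp [hz x (fun h => hx (hsupp h))]),
    setIntegral_eq_integral_of_forall_compl_eq_zero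
      (fun x hx => by simp [hz' x (fun h => hx (hsupp h))])]
  have iA : Integrable (fun x => ‖u x‖ ^ 2 * ‖x‖ ^ (-(2 * θ))) := by
    have z : ∀ x ∉ tsupport u, ‖u x‖ ^ 2 * ‖x‖ ^ (-(2 * θ)) = 0 := fun x hx => by simp [hz x hx]
    refine Continuous.integrable_of_hasCompactSupport (continuous_of_tsupport fun x hx => ?_)
      (cs _ z)
    have hp := hpos x (tsub _ z hx)
    exact (hu1.continuous.norm.pow 2).continuousAt.mul
      (continuous_norm.continuousAt.rpow_const (Or.inl hp.ne'))
  have iB : Integrable (fun x => ‖fderiv ℝ u x (‖x‖⁻¹ • x)‖ ^ 2 * ‖x‖ ^ (-(2 * (θ - 1)))) := by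
    have z : ∀ x ∉ tsupport u, ‖fderiv ℝ u x (‖x‖⁻¹ • x)‖ ^ 2 * ‖x‖ ^ (-(2 * (θ - 1))) = 0 :=
      fun x hx => by simp [hz' x hx]
    refine Continuous.integrable_of_hasCompactSupport (continuous_of_tsupport fun x hx => ?_)
      (cs _ z)
    have hp := hpos x (tsub _ z hx)
    have hv : ContinuousAt (fun x : EuclideanSpace ℝ (Fin N) => ‖x‖⁻¹ • x) x :=
      (continuous_norm.continuousAt.inv₀ hp.ne').smul continuousAt_id
    exact ((hfu.continuousAt.clm_apply hv).norm.pow 2).mul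
      (continuous_norm.continuousAt.rpow_const (Or.inl hp.ne'))
  rw [← integral_const_mul]
  have : ∫ x, ((k ^ 2 + w ^ 2) * (‖u x‖ ^ 2 * ‖x‖ ^ (-(2 * θ))) +
      (fderiv ℝ h x x + N * h x)) = ∫ x, (k ^ 2 + w ^ 2) * (‖u x‖ ^ 2 * ‖x‖ ^ (-(2 * θ))) := by
    rw [integral_add (iA.const_mul _) hI, hE, add_zero]
  rw [← this]
  refine integral_mono ((iA.const_mul _).add hI) iB fun x => ?_
  by_cases hx : x ∈ tsupport u
  · have hp := hpos x hx
    have hxn : x ≠ 0 := norm_pos_iff.1 hp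
    have hdn : DifferentiableAt ℝ (fun x : EuclideanSpace ℝ (Fin N) => ‖x‖) x :=
      (contDiffAt_norm ℝ hxn (n := 1)).differentiableAt one_ne_zero
    have hg' := (radial_deriv k w θ (log a) ‖x‖ hp (hsin x hx)).comp_hasFDerivAt x
      hdn.hasFDerivAt
    have hq := (hu1.differentiable one_ne_zero x).hasFDerivAt.norm_sq
    have hd := (hq.mul hg').fderiv
    have hd' : fderiv ℝ h x = _ := hd
    have hR : ‖fderiv ℝ u x (‖x‖⁻¹ • x)‖ ^ 2 * ‖x‖ ^ (-(2 * (θ - 1))) =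
        ‖fderiv ℝ u x x‖ ^ 2 * ‖x‖ ^ (-(2 * θ)) := by
      rw [map_smul, norm_smul, norm_inv, norm_norm,
        show -(2 * (θ - 1)) = -(2 * θ) + 2 by ring, rpow_add hp, rpow_two]
      field_simp
    have hfin := pointwise_alg (u x) (fderiv ℝ u x x) k w
      (cos (w * (log ‖x‖ - log a)) / sin (w * (log ‖x‖ - log a))) θ N (‖x‖ ^ (-(2 * θ)))
      (by rw [hk]; ring) (by positivity)
    beta_reduce
    rw [hR]
    refine le_trans (le_of_eq ?_) hfin
    rw [hd']
    have hnn : fderiv ℝ (fun x : EuclideanSpace ℝ (Fin N) => ‖x‖) x x = ‖x‖ :=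
      hdn.fderiv_norm_self
    simp [hnn, hh, hg]
    field_simp
    ring
  · have : h =ᶠ[nhds x] fun _ => 0 := by
      filter_upwards [(isClosed_tsupport u).isOpen_compl.mem_nhds hx] with y hy
      exact h0 y hy
    simp [this.fderiv_eq, h0 x hx, hz x hx, hz' x hx]
end
end
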